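/- (Carleman estimate with time-only weights and L² internal observation.) Let 0 < l1 < l2 < L, T > 0, let (ψ, l3) satisfy conditions (C1)–(C5), and set φ̌(t) := ψ(l3)/(t(T−t)) and φ̂(t) := ψ(0)/(t(T−t)). Then for every R > 0 there exist constants s̃0 > 0 and C > 0 such that for every ξ ∈ C^∞([0,T]×[0,L]) with ‖ξ‖_{C⁰([0,T];L²(0,L))} + ‖ξ‖_{L²(0,T;H¹(0,L))} ≤ R, every s ≥ s̃0, and every v ∈ C^∞([0,T]×[0,L]) satisfying −v_t − ξ v_x − v_xxx = 0 on (0,T)×(0,L) and v(t,0) = v(t,L) = v_x(t,0) = 0 for all t, one has: ∫₀^T∫₀^L [ (s φ̌)⁵ v² + (s φ̌)³ v_x² + s φ̌ v_xx² ] e^{−2s φ̂} dx dt ≤ C s^{10} ∫₀^T e^{s(6 φ̂ − 8 φ̌)} φ̌^{31} (∫_{l1}^{l2} v(t,x)² dx) dt. -/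

import Mathlib

noncomputable def pdx (f : ℝ → ℝ → ℝ) : ℝ → ℝ → ℝ := fun t x => deriv (f t) x
noncomputable def pdt (f : ℝ → ℝ → ℝ) : ℝ → ℝ → ℝ := fun t x => deriv (fun s => f s x) t

section SmoothTwoVariables

variable {f : ℝ → ℝ → ℝ}

theorem hasDerivAt_slice_right (hf : ContDiff ℝ (⊤ : ℕ∞) (Function.uncurry f)) (t x : ℝ) :
    HasDerivAt (f t) (fderiv ℝ (Function.uncurry f) (t, x) (0, 1)) x := by
  have h1 : HasFDerivAt (Function.uncurry f) (fderiv ℝ (Function.uncurry f) (t, x)) (t, x) :=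
    (hf.differentiable (by simp)).differentiableAt.hasFDerivAt
  have h2 : HasDerivAt (fun y : ℝ => (t, y)) ((0 : ℝ), (1 : ℝ)) x :=
    (hasDerivAt_const x t).prodMk (hasDerivAt_id x)
  exact h1.comp_hasDerivAt x h2

theorem hasDerivAt_slice_left (hf : ContDiff ℝ (⊤ : ℕ∞) (Function.uncurry f)) (t x : ℝ) :
    HasDerivAt (fun s => f s x) (fderiv ℝ (Function.uncurry f) (t, x) (1, 0)) t := by
  have h1 : HasFDerivAt (Function.uncurry f) (fderiv ℝ (Function.uncurry f) (t, x)) (t, x) :=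
    (hf.differentiable (by simp)).differentiableAt.hasFDerivAt
  have h2 : HasDerivAt (fun y : ℝ => (y, x)) ((1 : ℝ), (0 : ℝ)) t :=
    (hasDerivAt_id t).prodMk (hasDerivAt_const t x)
  exact h1.comp_hasDerivAt t h2

theorem pdx_eq_fderiv (hf : ContDiff ℝ (⊤ : ℕ∞) (Function.uncurry f)) (t x : ℝ) :
    pdx f t x = fderiv ℝ (Function.uncurry f) (t, x) (0, 1) :=
  (hasDerivAt_slice_right hf t x).deriv

theorem pdt_eq_fderiv (hf : ContDiff ℝ (⊤ : ℕ∞) (Function.uncurry f)) (t x : ℝ) :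
    pdt f t x = fderiv ℝ (Function.uncurry f) (t, x) (1, 0) :=
  (hasDerivAt_slice_left hf t x).deriv

theorem hasDerivAt_pdx (hf : ContDiff ℝ (⊤ : ℕ∞) (Function.uncurry f)) (t x : ℝ) :
    HasDerivAt (f t) (pdx f t x) x :=
  pdx_eq_fderiv hf t x ▸ hasDerivAt_slice_right hf t x

theorem hasDerivAt_pdt (hf : ContDiff ℝ (⊤ : ℕ∞) (Function.uncurry f)) (t x : ℝ) :
    HasDerivAt (fun s => f s x) (pdt f t x) t :=
  pdt_eq_fderiv hf t x ▸ hasDerivAt_slice_left hf t x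

theorem contDiff_pdx (hf : ContDiff ℝ (⊤ : ℕ∞) (Function.uncurry f)) :
    ContDiff ℝ (⊤ : ℕ∞) (Function.uncurry (pdx f)) := by
  have : Function.uncurry (pdx f) = fun p => fderiv ℝ (Function.uncurry f) p (0, 1) := by
    ext ⟨t, x⟩
    exact pdx_eq_fderiv hf t x
  rw [this]
  exact (hf.fderiv_right (m := (⊤ : ℕ∞)) (by simp)).clm_apply contDiff_const

theorem contDiff_pdt (hf : ContDiff ℝ (⊤ : ℕ∞) (Function.uncurry f)) :
    ContDiff ℝ (⊤ : ℕ∞) (Function.uncurry (pdt f)) := by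
  have : Function.uncurry (pdt f) = fun p => fderiv ℝ (Function.uncurry f) p (1, 0) := by
    ext ⟨t, x⟩
    exact pdt_eq_fderiv hf t x
  rw [this]
  exact (hf.fderiv_right (m := (⊤ : ℕ∞)) (by simp)).clm_apply contDiff_const

theorem pdt_pdx_comm (hf : ContDiff ℝ (⊤ : ℕ∞) (Function.uncurry f)) :
    pdt (pdx f) = pdx (pdt f) := by
  have hd : Differentiable ℝ (fderiv ℝ (Function.uncurry f)) :=
    (hf.fderiv_right (m := (⊤ : ℕ∞)) (by simp)).differentiable (by simp)
  have key : ∀ (p : ℝ × ℝ) (a b : ℝ × ℝ),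
      fderiv ℝ (fun q => fderiv ℝ (Function.uncurry f) q a) p b
        = fderiv ℝ (fderiv ℝ (Function.uncurry f)) p b a := by
    intro p a b
    rw [fderiv_clm_apply (hd p) (differentiableAt_const a)]
    simp
  have hsymm : ∀ p : ℝ × ℝ, IsSymmSndFDerivAt ℝ (Function.uncurry f) p := fun p =>
    (hf.contDiffAt (x := p)).isSymmSndFDerivAt (by
      simp only [minSmoothness_of_isRCLikeNormedField]
      exact WithTop.coe_le_coe.2 (le_top : (2 : ℕ∞) ≤ ⊤))
  have hx : Function.uncurry (pdx f) = fun p => fderiv ℝ (Function.uncurry f) p (0, 1) := by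
    ext ⟨t, x⟩
    exact pdx_eq_fderiv hf t x
  have ht : Function.uncurry (pdt f) = fun p => fderiv ℝ (Function.uncurry f) p (1, 0) := by
    ext ⟨t, x⟩
    exact pdt_eq_fderiv hf t x
  ext t x
  rw [pdt_eq_fderiv (contDiff_pdx hf), pdx_eq_fderiv (contDiff_pdt hf), hx, ht, key, key]
  exact hsymm (t, x) _ _

theorem continuous_slice (hf : ContDiff ℝ (⊤ : ℕ∞) (Function.uncurry f)) (t : ℝ) :
    Continuous (f t) :=
  hf.continuous.comp (by fun_prop : Continuous fun x : ℝ => (t, x))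

end SmoothTwoVariables

open Set in
/-- Differentiation under the integral sign for an integrand which is `C¹` in the parameter. -/
theorem hasDerivAt_intervalIntegral_of_continuousOn {F F' : ℝ → ℝ → ℝ} {a b c d : ℝ} (hcd : c ≤ d)
    (hF : ∀ t ∈ Ioo a b, ContinuousOn (F t) (Icc c d))
    (hd : ∀ t ∈ Ioo a b, ∀ x ∈ Icc c d, HasDerivAt (fun s => F s x) (F' t x) t)
    (hF' : ContinuousOn (Function.uncurry F') (Ioo a b ×ˢ Icc c d)) {t : ℝ} (ht : t ∈ Ioo a b) :
    HasDerivAt (fun s => ∫ x in c..d, F s x) (∫ x in c..d, F' t x) t := by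
  obtain ⟨a', ha', ha't⟩ := exists_between ht.1
  obtain ⟨b', hb't, hb'⟩ := exists_between ht.2
  have hsub : Icc a' b' ⊆ Ioo a b := fun s hs => ⟨ha'.trans_le hs.1, hs.2.trans_lt hb'⟩
  obtain ⟨K, hK⟩ := (isCompact_Icc.prod isCompact_Icc).exists_bound_of_continuousOn
    (hF'.mono (prod_mono hsub (Subset.refl (Icc c d))))
  have hunit : uIoc c d = Ioc c d := uIoc_of_le hcd
  have hF't : ContinuousOn (F' t) (Icc c d) :=
    hF'.comp (f := fun x => (t, x)) (by fun_prop) fun x hx => ⟨ht, hx⟩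
  have hmeas : ∀ g : ℝ → ℝ, ContinuousOn g (Icc c d) →
      MeasureTheory.AEStronglyMeasurable g (MeasureTheory.volume.restrict (uIoc c d)) := by
    intro g hg
    rw [hunit]
    exact (hg.mono Ioc_subset_Icc_self).aestronglyMeasurable measurableSet_Ioc
  refine (intervalIntegral.hasDerivAt_integral_of_dominated_loc_of_deriv_le
    (F := F) (F' := F') (bound := fun _ => K) (s := Icc a' b') (Icc_mem_nhds ha't hb't)
    ?_ ?_ (hmeas _ hF't) ?_ ?_ ?_).2
  · filter_upwards [Ioo_mem_nhds ht.1 ht.2] with s hs using hmeas _ (hF s hs)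
  · exact (hF t ht).intervalIntegrable_of_Icc hcd
  · refine Filter.Eventually.of_forall fun x hx s hs => ?_
    rw [hunit] at hx
    exact hK (s, x) ⟨hs, Ioc_subset_Icc_self hx⟩
  · exact intervalIntegrable_const
  · refine Filter.Eventually.of_forall fun x hx s hs => ?_
    rw [hunit] at hx
    exact hd s (hsub hs) x (Ioc_subset_Icc_self hx)

/-- A spatial weight `b0` with derivatives `b1, b2, b3`, satisfying the pseudoconvexity conditions
of the Carleman estimate for `∂t + ∂x³` up to an error carried by the observation density `P`. -/
structure CarlemanWeight (L : ℝ) where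
  (b0 b1 b2 b3 P : ℝ → ℝ)
  (c K B : ℝ)
  d0 : ∀ x, HasDerivAt b0 (b1 x) x
  d1 : ∀ x, HasDerivAt b1 (b2 x) x
  d2 : ∀ x, HasDerivAt b2 (b3 x) x
  cont3 : Continuous b3
  contP : Continuous P
  P_nonneg : ∀ x, 0 ≤ P x
  c_pos : 0 < c
  K_nonneg : 0 ≤ K
  one_le_B : 1 ≤ B
  abs_b0 : ∀ x ∈ Set.Icc 0 L, |b0 x| ≤ B
  abs_b1 : ∀ x ∈ Set.Icc 0 L, |b1 x| ≤ B
  abs_b2 : ∀ x ∈ Set.Icc 0 L, |b2 x| ≤ B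
  abs_b3 : ∀ x ∈ Set.Icc 0 L, |b3 x| ≤ B
  conv2 : ∀ x ∈ Set.Icc 0 L, c - K * P x ≤ -b2 x
  conv1 : ∀ x ∈ Set.Icc 0 L, c - K * P x ≤ -2 * b1 x ^ 2 * b2 x
  conv0 : ∀ x ∈ Set.Icc 0 L, c - K * P x ≤ -b1 x ^ 4 * b2 x
  left_neg : b1 0 < 0
  right_pos : 0 < b1 L

namespace CarlemanWeight

variable {L : ℝ} (W : CarlemanWeight L)

theorem cont0 : Continuous W.b0 := continuous_iff_continuousAt.2 fun x => (W.d0 x).continuousAt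
theorem cont1 : Continuous W.b1 := continuous_iff_continuousAt.2 fun x => (W.d1 x).continuousAt
theorem cont2 : Continuous W.b2 := continuous_iff_continuousAt.2 fun x => (W.d2 x).continuousAt

end CarlemanWeight

/-- The integrated commutator identity for the conjugated operator. -/
theorem conjugated_commutator_identity {L : ℝ} {p1 p2 p3 w0 w1 w2 w3 wt wt1 : ℝ → ℝ}
    (hp1 : ∀ x, HasDerivAt p1 (p2 x) x) (hp2 : ∀ x, HasDerivAt p2 (p3 x) x) (hp3 : Continuous p3)
    (hw0 : ∀ x, HasDerivAt w0 (w1 x) x) (hw1 : ∀ x, HasDerivAt w1 (w2 x) x)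
    (hw2 : ∀ x, HasDerivAt w2 (w3 x) x) (hw3 : Continuous w3)
    (hwt : ∀ x, HasDerivAt wt (wt1 x) x) (hwt1 : Continuous wt1)
    (h00 : w0 0 = 0) (h10 : w1 0 = 0) (h0L : w0 L = 0) (htL : wt L = 0) :
    ∫ x in (0 : ℝ)..L, (2 * (wt x + w3 x + 3 * p1 x ^ 2 * w1 x + 3 * p1 x * p2 x * w0 x)
        * (3 * p1 x * w2 x + 3 * p2 x * w1 x + p1 x ^ 3 * w0 x)
      - (-6 * p1 x * w1 x * wt1 x + 2 * p1 x ^ 3 * w0 x * wt x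
        - 9 * p2 x * w2 x ^ 2 - 18 * p1 x ^ 2 * p2 x * w1 x ^ 2 - 9 * p1 x ^ 4 * p2 x * w0 x ^ 2
        - 6 * p3 x * w2 x * w1 x - 12 * (2 * p1 x * p2 x ^ 2 + p1 x ^ 2 * p3 x) * w0 x * w1 x
        + 18 * p1 x * p2 x ^ 2 * w0 x * w1 x))
      = 3 * p1 L * w2 L ^ 2 + 6 * p2 L * w2 L * w1 L + 8 * p1 L ^ 3 * w1 L ^ 2
        - 3 * p1 0 * w2 0 ^ 2 := by
  have c1 : Continuous p1 := continuous_iff_continuousAt.2 fun x => (hp1 x).continuousAt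
  have c2 : Continuous p2 := continuous_iff_continuousAt.2 fun x => (hp2 x).continuousAt
  have cw0 : Continuous w0 := continuous_iff_continuousAt.2 fun x => (hw0 x).continuousAt
  have cw1 : Continuous w1 := continuous_iff_continuousAt.2 fun x => (hw1 x).continuousAt
  have cw2 : Continuous w2 := continuous_iff_continuousAt.2 fun x => (hw2 x).continuousAt
  have cwt : Continuous wt := continuous_iff_continuousAt.2 fun x => (hwt x).continuousAt
  have key : ∀ x, HasDerivAt (fun x => 6 * (wt x * (p1 x * w1 x)) + 3 * (p1 x * w2 x ^ 2)
      + 6 * (p2 x * (w2 x * w1 x)) + 2 * (p1 x ^ 3 * (w0 x * w2 x)) + 8 * (p1 x ^ 3 * w1 x ^ 2)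
      + 12 * (p1 x ^ 2 * (p2 x * (w0 x * w1 x))) + 3 * (p1 x ^ 5 * w0 x ^ 2))
      (2 * (wt x + w3 x + 3 * p1 x ^ 2 * w1 x + 3 * p1 x * p2 x * w0 x)
        * (3 * p1 x * w2 x + 3 * p2 x * w1 x + p1 x ^ 3 * w0 x)
      - (-6 * p1 x * w1 x * wt1 x + 2 * p1 x ^ 3 * w0 x * wt x
        - 9 * p2 x * w2 x ^ 2 - 18 * p1 x ^ 2 * p2 x * w1 x ^ 2 - 9 * p1 x ^ 4 * p2 x * w0 x ^ 2
        - 6 * p3 x * w2 x * w1 x - 12 * (2 * p1 x * p2 x ^ 2 + p1 x ^ 2 * p3 x) * w0 x * w1 x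
        + 18 * p1 x * p2 x ^ 2 * w0 x * w1 x)) x := by
    intro x
    have := (((((((hwt x).fun_mul ((hp1 x).fun_mul (hw1 x))).const_mul 6).fun_add
      (((hp1 x).fun_mul ((hw2 x).fun_pow 2)).const_mul 3)).fun_add
      (((hp2 x).fun_mul ((hw2 x).fun_mul (hw1 x))).const_mul 6)).fun_add
      ((((hp1 x).fun_pow 3).fun_mul ((hw0 x).fun_mul (hw2 x))).const_mul 2)).fun_add
      ((((hp1 x).fun_pow 3).fun_mul ((hw1 x).fun_pow 2)).const_mul 8)).fun_add
      ((((hp1 x).fun_pow 2).fun_mul ((hp2 x).fun_mul ((hw0 x).fun_mul (hw1 x)))).const_mul 12)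
    have := this.fun_add ((((hp1 x).fun_pow 5).fun_mul ((hw0 x).fun_pow 2)).const_mul 3)
    refine this.congr_deriv ?_
    push_cast
    ring
  rw [intervalIntegral.integral_eq_sub_of_hasDerivAt (fun x _ => key x)
    (Continuous.intervalIntegrable (by fun_prop) _ _)]
  simp only [h00, h10, h0L, htL]
  ring

/-- Pointwise positivity of the commutator form, with `X = w_xx`, `Y = σ w_x`, `Z = σ² w`. -/
theorem commutator_form_lower_bound {σ κ b1 b2 b3 c q B X Y Z : ℝ} (hσ : 0 ≤ σ) (hκ : |κ| ≤ 1)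
    (hB : 1 ≤ B) (h1 : |b1| ≤ B) (h2 : |b2| ≤ B) (h3 : |b3| ≤ B)
    (hc2 : c - q ≤ -b2) (hc1 : c - q ≤ -2 * b1 ^ 2 * b2) (hc0 : c - q ≤ -b1 ^ 4 * b2) :
    (9 * σ * (c - q) - 60 * B ^ 3) * (X ^ 2 + Y ^ 2 + Z ^ 2) ≤
      -9 * σ * b2 * X ^ 2 - 18 * σ * b1 ^ 2 * b2 * Y ^ 2 - 9 * σ * b1 ^ 4 * b2 * Z ^ 2
        - 6 * b3 * X * Y - 12 * (2 * b1 * b2 ^ 2 + b1 ^ 2 * b3) * Z * Y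
        + 18 * b1 * b2 ^ 2 * Z * Y + 3 * κ * b1 * Y ^ 2 - 3 * κ * b1 ^ 3 * Z ^ 2 := by
  have hB0 : 0 ≤ B := by linarith
  have prod : ∀ {a u v d : ℝ}, |a| ≤ d → a * u * v ≤ d * (u ^ 2 + v ^ 2) := by
    intro a u v d had
    have : a * u * v ≤ |a| * (u ^ 2 + v ^ 2) := by
      rw [mul_assoc]
      calc a * (u * v) ≤ |a * (u * v)| := le_abs_self _
        _ = |a| * |u * v| := abs_mul _ _
        _ ≤ |a| * (u ^ 2 + v ^ 2) := by
          gcongr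
          rw [abs_le]
          constructor <;> nlinarith [sq_nonneg (u + v), sq_nonneg (u - v)]
    exact this.trans (by gcongr)
  have hB3 : B ≤ B ^ 3 := le_self_pow₀ hB (by norm_num)
  have e1 : |-6 * b3 * -1| ≤ 6 * B ^ 3 := by
    rw [abs_mul, abs_mul]; norm_num; linarith
  have e2 : |12 * (2 * b1 * b2 ^ 2 + b1 ^ 2 * b3) - 18 * b1 * b2 ^ 2| ≤ 30 * B ^ 3 := by
    have i1 : |b1 * b2 ^ 2| ≤ B ^ 3 := by
      rw [abs_mul, abs_pow]
      calc |b1| * |b2| ^ 2 ≤ B * B ^ 2 := by gcongr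
        _ = B ^ 3 := by ring
    have i2 : |b1 ^ 2 * b3| ≤ B ^ 3 := by
      rw [abs_mul, abs_pow]
      calc |b1| ^ 2 * |b3| ≤ B ^ 2 * B := by gcongr
        _ = B ^ 3 := by ring
    rw [abs_le] at i1 i2 ⊢
    constructor <;> linarith [i1.1, i1.2, i2.1, i2.2]
  have e3 : |-3 * κ * b1| ≤ 3 * B ^ 3 := by
    rw [abs_mul, abs_mul, abs_neg, abs_of_pos (by norm_num : (0 : ℝ) < 3)]
    calc 3 * |κ| * |b1| ≤ 3 * 1 * B := by gcongr
      _ ≤ 3 * B ^ 3 := by linarith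
  have e4 : |3 * κ * b1 ^ 3| ≤ 3 * B ^ 3 := by
    rw [abs_mul, abs_mul, abs_of_pos (by norm_num : (0 : ℝ) < 3), abs_pow]
    calc 3 * |κ| * |b1| ^ 3 ≤ 3 * 1 * B ^ 3 := by gcongr
      _ = 3 * B ^ 3 := by ring
  have f1 := prod (u := X) (v := Y) e1
  have f2 := prod (u := Z) (v := Y) e2
  have f3 := prod (u := Y) (v := Y) e3
  have f4 := prod (u := Z) (v := Z) e4
  have g2 := mul_le_mul_of_nonneg_right hc2 (by positivity : 0 ≤ 9 * σ * X ^ 2)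
  have g1 := mul_le_mul_of_nonneg_right hc1 (by positivity : 0 ≤ 9 * σ * Y ^ 2)
  have g0 := mul_le_mul_of_nonneg_right hc0 (by positivity : 0 ≤ 9 * σ * Z ^ 2)
  have hpos : ∀ u : ℝ, 0 ≤ B ^ 3 * u ^ 2 := fun u => by positivity
  nlinarith [hpos X, hpos Y, hpos Z]

open Set in
theorem CarlemanWeight.conjugated_estimate {L : ℝ} (hL : 0 < L) (W : CarlemanWeight L)
    {σ σ₁ : ℝ} (hσ : 1 ≤ σ) (hσ₁ : |σ₁| ≤ σ ^ 2) (hσc : 60 * W.B ^ 3 ≤ σ * W.c)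
    (hσL : W.B ≤ σ * W.b1 L) (hσL' : W.B ≤ σ * W.b1 L ^ 3) {w0 w1 w2 w3 wt wt1 : ℝ → ℝ}
    (hw0 : ∀ x, HasDerivAt w0 (w1 x) x) (hw1 : ∀ x, HasDerivAt w1 (w2 x) x)
    (hw2 : ∀ x, HasDerivAt w2 (w3 x) x) (hw3 : Continuous w3)
    (hwt : ∀ x, HasDerivAt wt (wt1 x) x) (hwt1 : Continuous wt1)
    (h00 : w0 0 = 0) (h10 : w1 0 = 0) (h0L : w0 L = 0) (htL : wt L = 0) :
    (∫ x in (0 : ℝ)..L, (-3 * σ₁ * W.b1 x * w1 x ^ 2 - 6 * σ * W.b1 x * w1 x * wt1 x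
        + 3 * σ ^ 2 * σ₁ * W.b1 x ^ 3 * w0 x ^ 2 + 2 * σ ^ 3 * W.b1 x ^ 3 * w0 x * wt x))
      + 8 * W.c * σ * ∫ x in (0 : ℝ)..L, (w2 x ^ 2 + (σ * w1 x) ^ 2 + (σ ^ 2 * w0 x) ^ 2)
      ≤ 9 * W.K * σ * (∫ x in (0 : ℝ)..L,
          W.P x * (w2 x ^ 2 + (σ * w1 x) ^ 2 + (σ ^ 2 * w0 x) ^ 2))
        + ∫ x in (0 : ℝ)..L, (wt x + w3 x + 3 * (σ * W.b1 x) ^ 2 * w1 x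
          + 3 * (σ * W.b1 x) * (σ * W.b2 x) * w0 x + 3 * (σ * W.b1 x) * w2 x
          + 3 * (σ * W.b2 x) * w1 x + (σ * W.b1 x) ^ 3 * w0 x) ^ 2 := by
  have c1 := W.cont1
  have c2 := W.cont2
  have c3 := W.cont3
  have cP := W.contP
  have cw0 : Continuous w0 := continuous_iff_continuousAt.2 fun x => (hw0 x).continuousAt
  have cw1 : Continuous w1 := continuous_iff_continuousAt.2 fun x => (hw1 x).continuousAt
  have cw2 : Continuous w2 := continuous_iff_continuousAt.2 fun x => (hw2 x).continuousAt
  have cwt : Continuous wt := continuous_iff_continuousAt.2 fun x => (hwt x).continuousAt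
  have hσ0 : 0 < σ := by linarith
  have hB := W.one_le_B
  have id := conjugated_commutator_identity (L := L)
    (p1 := fun x => σ * W.b1 x) (p2 := fun x => σ * W.b2 x) (p3 := fun x => σ * W.b3 x)
    (fun x => (W.d1 x).const_mul σ) (fun x => (W.d2 x).const_mul σ) (by fun_prop)
    hw0 hw1 hw2 hw3 hwt hwt1 h00 h10 h0L htL
  have bdry : 0 ≤ 3 * (σ * W.b1 L) * w2 L ^ 2 + 6 * (σ * W.b2 L) * w2 L * w1 L
      + 8 * (σ * W.b1 L) ^ 3 * w1 L ^ 2 - 3 * (σ * W.b1 0) * w2 0 ^ 2 := by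
    have h0 : 0 ≤ -(σ * W.b1 0) * w2 0 ^ 2 :=
      mul_nonneg (by nlinarith [W.left_neg]) (sq_nonneg _)
    have h2 := abs_le.1 (W.abs_b2 L (right_mem_Icc.2 hL.le))
    have hY : 6 * (σ * W.b2 L) * w2 L * w1 L = 6 * W.b2 L * (w2 L * (σ * w1 L)) := by ring
    have hY' : 8 * (σ * W.b1 L) ^ 3 * w1 L ^ 2 = 8 * (σ * W.b1 L ^ 3) * (σ * w1 L) ^ 2 := by ring
    rw [hY, hY']
    generalize σ * w1 L = Y
    generalize w2 L = X
    have k1 := mul_le_mul_of_nonneg_right hσL (sq_nonneg X)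
    have k2 := mul_le_mul_of_nonneg_right hσL' (sq_nonneg Y)
    have k3 : -(W.B * (X ^ 2 + Y ^ 2)) ≤ 2 * W.b2 L * (X * Y) := by
      nlinarith [mul_nonneg (sub_nonneg.2 h2.2) (sq_nonneg (X - Y)),
        mul_nonneg (by linarith [h2.1] : 0 ≤ W.b2 L + W.B) (sq_nonneg (X + Y))]
    nlinarith [mul_nonneg (by linarith : 0 ≤ W.B) (sq_nonneg Y)]
  rw [← id] at bdry
  rw [← intervalIntegral.integral_const_mul, ← intervalIntegral.integral_const_mul,
    ← intervalIntegral.integral_add (Continuous.intervalIntegrable (by fun_prop) _ _)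
      (Continuous.intervalIntegrable (by fun_prop) _ _),
    ← intervalIntegral.integral_add (Continuous.intervalIntegrable (by fun_prop) _ _)
      (Continuous.intervalIntegrable (by fun_prop) _ _)]
  refine (le_add_of_nonneg_right bdry).trans ?_
  rw [← intervalIntegral.integral_add (Continuous.intervalIntegrable (by fun_prop) _ _)
      (Continuous.intervalIntegrable (by fun_prop) _ _)]
  refine intervalIntegral.integral_mono_on hL.le (Continuous.intervalIntegrable (by fun_prop) _ _)
    (Continuous.intervalIntegrable (by fun_prop) _ _) fun x hx => ?_
  have hκ : |σ₁ / σ ^ 2| ≤ 1 := by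
    rw [abs_div, abs_of_pos (by positivity : 0 < σ ^ 2)]
    exact div_le_one_of_le₀ hσ₁ (by positivity)
  have form := commutator_form_lower_bound (X := w2 x) (Y := σ * w1 x) (Z := σ ^ 2 * w0 x)
    hσ0.le hκ hB (W.abs_b1 x hx) (W.abs_b2 x hx) (W.abs_b3 x hx)
    (W.conv2 x hx) (W.conv1 x hx) (W.conv0 x hx)
  obtain ⟨κ, hκ'⟩ : ∃ κ, κ = σ₁ / σ ^ 2 := ⟨_, rfl⟩
  rw [← hκ'] at form
  have hσ₁' : σ₁ = κ * σ ^ 2 := by rw [hκ']; field_simp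
  rw [hσ₁']
  have hN : 0 ≤ w2 x ^ 2 + (σ * w1 x) ^ 2 + (σ ^ 2 * w0 x) ^ 2 := by positivity
  have hcN := mul_le_mul_of_nonneg_right hσc hN
  have sq := sq_nonneg ((wt x + w3 x + 3 * (σ * W.b1 x) ^ 2 * w1 x
          + 3 * (σ * W.b1 x) * (σ * W.b2 x) * w0 x) - (3 * (σ * W.b1 x) * w2 x
          + 3 * (σ * W.b2 x) * w1 x + (σ * W.b1 x) ^ 3 * w0 x))
  have sq2 := sq_nonneg (wt x + w3 x + 3 * (σ * W.b1 x) ^ 2 * w1 x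
          + 3 * (σ * W.b1 x) * (σ * W.b2 x) * w0 x)
  have sq3 := sq_nonneg (3 * (σ * W.b1 x) * w2 x
          + 3 * (σ * W.b2 x) * w1 x + (σ * W.b1 x) ^ 3 * w0 x)
  linarith

/-- Algebra for passing from the conjugated unknown back to the original one. -/
theorem conjugation_norm_equiv {B p q X Y Z X' Y' : ℝ} (hB : 1 ≤ B) (hp : |p| ≤ B)
    (hq : |q| ≤ 2 * B ^ 2) (hX : X' = X + 2 * p * Y + q * Z) (hY : Y' = Y + p * Z) :
    X' ^ 2 + Y' ^ 2 + Z ^ 2 ≤ 20 * B ^ 4 * (X ^ 2 + Y ^ 2 + Z ^ 2) := by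
  have hp2 : p ^ 2 ≤ B ^ 2 := sq_le_sq' (by linarith [(abs_le.1 hp).1]) (abs_le.1 hp).2
  have hq2 : q ^ 2 ≤ 4 * B ^ 4 := by
    have := sq_le_sq' (by linarith [(abs_le.1 hq).1]) (abs_le.1 hq).2
    nlinarith
  have hB2 : 1 ≤ B ^ 2 := one_le_pow₀ hB
  have hB4 : B ^ 2 ≤ B ^ 4 := pow_le_pow_right₀ hB (by norm_num)
  have hX2 : X' ^ 2 ≤ 3 * (X ^ 2 + 4 * p ^ 2 * Y ^ 2 + q ^ 2 * Z ^ 2) := by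
    rw [hX]
    nlinarith [sq_nonneg (X - 2 * p * Y), sq_nonneg (X - q * Z), sq_nonneg (2 * p * Y - q * Z)]
  have hY2 : Y' ^ 2 ≤ 2 * (Y ^ 2 + p ^ 2 * Z ^ 2) := by
    rw [hY]
    nlinarith [sq_nonneg (Y - p * Z)]
  have a1 := mul_le_mul_of_nonneg_right hp2 (sq_nonneg Y)
  have a2 := mul_le_mul_of_nonneg_right hp2 (sq_nonneg Z)
  have a3 := mul_le_mul_of_nonneg_right hq2 (sq_nonneg Z)
  have b1 := mul_le_mul_of_nonneg_right hB2 (sq_nonneg X)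
  have b2 := mul_le_mul_of_nonneg_right hB2 (sq_nonneg Y)
  have b3 := mul_le_mul_of_nonneg_right hB2 (sq_nonneg Z)
  have c1 := mul_le_mul_of_nonneg_right hB4 (sq_nonneg X)
  have c2 := mul_le_mul_of_nonneg_right hB4 (sq_nonneg Y)
  have c3 := mul_le_mul_of_nonneg_right hB4 (sq_nonneg Z)
  nlinarith [sq_nonneg X, sq_nonneg Y, sq_nonneg Z]

open Set in
/-- A weighted Agmon inequality for a function vanishing at the left end point. -/
theorem sq_le_integral_of_hasDerivAt {L σ : ℝ} (hσ : 0 < σ) {z z' : ℝ → ℝ}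
    (hz : ∀ x, HasDerivAt z (z' x) x) (hz' : Continuous z') (h0 : z 0 = 0) {x : ℝ}
    (hx : x ∈ Icc 0 L) : z x ^ 2 ≤ ∫ y in (0 : ℝ)..L, (σ * z y ^ 2 + z' y ^ 2 / σ) := by
  have cz : Continuous z := continuous_iff_continuousAt.2 fun x => (hz x).continuousAt
  have key : ∀ y, HasDerivAt (fun y => z y ^ 2) (2 * z y * z' y) y := fun y =>
    ((hz y).fun_pow 2).congr_deriv (by push_cast; ring)
  have ftc := intervalIntegral.integral_eq_sub_of_hasDerivAt (a := 0) (b := x)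
    (fun y _ => key y) (Continuous.intervalIntegrable (by fun_prop) _ _)
  have hz0 : z x ^ 2 = ∫ y in (0 : ℝ)..x, 2 * z y * z' y := by rw [ftc, h0]; ring
  rw [hz0]
  calc ∫ y in (0 : ℝ)..x, 2 * z y * z' y ≤ ∫ y in (0 : ℝ)..x, (σ * z y ^ 2 + z' y ^ 2 / σ) := by
        refine intervalIntegral.integral_mono_on hx.1
          (Continuous.intervalIntegrable (by fun_prop) _ _)
          (Continuous.intervalIntegrable (by fun_prop) _ _) fun y _ => ?_
        have : σ * z y ^ 2 + z' y ^ 2 / σ - 2 * z y * z' y = (σ * z y - z' y) ^ 2 / σ := by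
          field_simp
          ring
        have : 0 ≤ (σ * z y - z' y) ^ 2 / σ := by positivity
        linarith
    _ ≤ _ := by
        refine intervalIntegral.integral_mono_interval le_rfl hx.1 hx.2
          (Filter.Eventually.of_forall fun y => ?_)
          (Continuous.intervalIntegrable (by fun_prop) _ _)
        show 0 ≤ σ * z y ^ 2 + z' y ^ 2 / σ
        positivity

set_option maxHeartbeats 1000000 in
open Set in
/-- The Carleman inequality at a fixed time: the first integral is the time derivative of
`∫ (-3 σ β' w_x² + σ³ β'³ w²)`, where `w = exp (-σ β) v` and `σ₁` stands for `dσ/dt`. -/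
theorem CarlemanWeight.slice_estimate {L : ℝ} (hL : 0 < L) (W : CarlemanWeight L) (R : ℝ) :
    ∃ σ₀ κ K' : ℝ, 1 ≤ σ₀ ∧ 0 < κ ∧ 0 ≤ K' ∧ ∀ σ ≥ σ₀, ∀ σ₁ : ℝ, |σ₁| ≤ σ ^ 2 →
      ∀ ξ v0 v1 v2 v3 vt vt1 : ℝ → ℝ, Continuous ξ → (∫ x in (0 : ℝ)..L, ξ x ^ 2) ≤ R ^ 2 →
      (∀ x, HasDerivAt v0 (v1 x) x) → (∀ x, HasDerivAt v1 (v2 x) x) →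
      (∀ x, HasDerivAt v2 (v3 x) x) → Continuous v3 →
      (∀ x, HasDerivAt vt (vt1 x) x) → Continuous vt1 →
      (∀ x ∈ Icc 0 L, vt x = -(ξ x * v1 x) - v3 x) →
      v0 0 = 0 → v1 0 = 0 → v0 L = 0 → vt L = 0 →
      (∫ x in (0 : ℝ)..L,
          (-3 * σ₁ * W.b1 x * (Real.exp (-(σ * W.b0 x)) * (v1 x - σ * W.b1 x * v0 x)) ^ 2
          - 6 * σ * W.b1 x * (Real.exp (-(σ * W.b0 x)) * (v1 x - σ * W.b1 x * v0 x))
            * (Real.exp (-(σ * W.b0 x)) * (vt1 x - σ₁ * (W.b1 x * v0 x + W.b0 x * v1 x)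
              - σ * W.b1 x * (vt x - σ₁ * (W.b0 x * v0 x))))
          + 3 * σ ^ 2 * σ₁ * W.b1 x ^ 3 * (Real.exp (-(σ * W.b0 x)) * v0 x) ^ 2
          + 2 * σ ^ 3 * W.b1 x ^ 3 * (Real.exp (-(σ * W.b0 x)) * v0 x)
            * (Real.exp (-(σ * W.b0 x)) * (vt x - σ₁ * (W.b0 x * v0 x)))))
        + κ * σ * (∫ x in (0 : ℝ)..L, Real.exp (-(σ * W.b0 x)) ^ 2
            * (v2 x ^ 2 + (σ * v1 x) ^ 2 + (σ ^ 2 * v0 x) ^ 2))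
        ≤ K' * σ * ∫ x in (0 : ℝ)..L, W.P x * (Real.exp (-(σ * W.b0 x)) ^ 2
            * (v2 x ^ 2 + (σ * v1 x) ^ 2 + (σ ^ 2 * v0 x) ^ 2)) := by
  have hc := W.c_pos
  have hB := W.one_le_B
  have hB0 : 0 < W.B := by linarith
  have hbL := W.right_pos
  have hK := W.K_nonneg
  refine ⟨max (max 1 (60 * W.B ^ 3 / W.c)) (max (max (W.B / W.b1 L) (W.B / W.b1 L ^ 3))
    ((20 * R ^ 2 * W.B ^ 2 + 8 * W.B ^ 2) / W.c)), W.c / (20 * W.B ^ 4),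
    9 * W.K * (20 * W.B ^ 4), le_max_of_le_left (le_max_left _ _), by positivity, by positivity, ?_⟩
  intro σ hσ' σ₁ hσ₁ ξ v0 v1 v2 v3 vt vt1 cξ hξ hv0 hv1 hv2 cv3 hvt cvt1 pde h00 h10 h0L htL
  simp only [ge_iff_le, max_le_iff] at hσ'
  obtain ⟨⟨hσ, hσa⟩, ⟨hσb, hσc⟩, hσd⟩ := hσ'
  rw [div_le_iff₀ (by positivity)] at hσa hσb hσc hσd
  have hσ0 : 0 < σ := by linarith
  have c0 := W.cont0
  have c1 := W.cont1
  have c2 := W.cont2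
  have c3 := W.cont3
  have cP := W.contP
  have cv0 : Continuous v0 := continuous_iff_continuousAt.2 fun x => (hv0 x).continuousAt
  have cv1 : Continuous v1 := continuous_iff_continuousAt.2 fun x => (hv1 x).continuousAt
  have cv2 : Continuous v2 := continuous_iff_continuousAt.2 fun x => (hv2 x).continuousAt
  have cvt : Continuous vt := continuous_iff_continuousAt.2 fun x => (hvt x).continuousAt
  obtain ⟨e, he⟩ : ∃ e : ℝ → ℝ, ∀ x, e x = Real.exp (-(σ * W.b0 x)) := ⟨_, fun _ => rfl⟩
  have de : ∀ x, HasDerivAt e (-(σ * W.b1 x) * e x) x := by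
    intro x
    have h : e = fun x => Real.exp (-(σ * W.b0 x)) := funext he
    rw [h]
    exact (((W.d0 x).const_mul σ).fun_neg.exp).congr_deriv (by ring)
  have ce : Continuous e := continuous_iff_continuousAt.2 fun x => (de x).continuousAt
  simp only [← he]
  obtain ⟨w0, hw0⟩ : ∃ w : ℝ → ℝ, w = fun x => e x * v0 x := ⟨_, rfl⟩
  obtain ⟨w1, hw1⟩ : ∃ w : ℝ → ℝ, w = fun x => e x * (v1 x - σ * W.b1 x * v0 x) := ⟨_, rfl⟩
  obtain ⟨w2, hw2⟩ : ∃ w : ℝ → ℝ, w = fun x => e x * (v2 x - 2 * (σ * W.b1 x) * v1 x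
    + ((σ * W.b1 x) ^ 2 - σ * W.b2 x) * v0 x) := ⟨_, rfl⟩
  obtain ⟨w3, hw3⟩ : ∃ w : ℝ → ℝ, w = fun x => e x * (v3 x - 3 * (σ * W.b1 x) * v2 x
    + 3 * ((σ * W.b1 x) ^ 2 - σ * W.b2 x) * v1 x
    + (-(σ * W.b1 x) ^ 3 + 3 * (σ * W.b1 x) * (σ * W.b2 x) - σ * W.b3 x) * v0 x) := ⟨_, rfl⟩
  obtain ⟨wt, hwt⟩ : ∃ w : ℝ → ℝ, w = fun x => e x * (vt x - σ₁ * (W.b0 x * v0 x)) := ⟨_, rfl⟩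
  obtain ⟨wt1, hwt1⟩ : ∃ w : ℝ → ℝ, w = fun x => e x * (vt1 x
    - σ₁ * (W.b1 x * v0 x + W.b0 x * v1 x)
    - σ * W.b1 x * (vt x - σ₁ * (W.b0 x * v0 x))) := ⟨_, rfl⟩
  have dw0 : ∀ x, HasDerivAt w0 (w1 x) x := fun x => by
    rw [hw0, hw1]
    exact ((de x).fun_mul (hv0 x)).congr_deriv (by ring)
  have dw1 : ∀ x, HasDerivAt w1 (w2 x) x := fun x => by
    rw [hw1, hw2]
    exact ((de x).fun_mul ((hv1 x).fun_sub (((W.d1 x).const_mul σ).fun_mul (hv0 x)))).congr_deriv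
      (by ring)
  have dw2 : ∀ x, HasDerivAt w2 (w3 x) x := fun x => by
    rw [hw2, hw3]
    exact ((de x).fun_mul (((hv2 x).fun_sub ((((W.d1 x).const_mul σ).const_mul 2).fun_mul
      (hv1 x))).fun_add (((((W.d1 x).const_mul σ).fun_pow 2).fun_sub
      ((W.d2 x).const_mul σ)).fun_mul (hv0 x)))).congr_deriv (by push_cast; ring)
  have dwt : ∀ x, HasDerivAt wt (wt1 x) x := fun x => by
    rw [hwt, hwt1]
    exact ((de x).fun_mul ((hvt x).fun_sub (((W.d0 x).fun_mul (hv0 x)).const_mul σ₁))).congr_deriv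
      (by ring)
  have cw3 : Continuous w3 := by rw [hw3]; fun_prop
  have cwt1 : Continuous wt1 := by rw [hwt1]; fun_prop
  have cw0 : Continuous w0 := continuous_iff_continuousAt.2 fun x => (dw0 x).continuousAt
  have cw1 : Continuous w1 := continuous_iff_continuousAt.2 fun x => (dw1 x).continuousAt
  have cw2 : Continuous w2 := continuous_iff_continuousAt.2 fun x => (dw2 x).continuousAt
  have cwt : Continuous wt := continuous_iff_continuousAt.2 fun x => (dwt x).continuousAt
  have est := W.conjugated_estimate hL hσ hσ₁ hσa hσb hσc dw0 dw1 dw2 cw3 dwt cwt1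
    (by simp [hw0, h00]) (by simp [hw1, h00, h10]) (by simp [hw0, h0L]) (by simp [hwt, h0L, htL])
  have hI : ∫ x in (0 : ℝ)..L,
          (-3 * σ₁ * W.b1 x * (e x * (v1 x - σ * W.b1 x * v0 x)) ^ 2
          - 6 * σ * W.b1 x * (e x * (v1 x - σ * W.b1 x * v0 x))
            * (e x * (vt1 x - σ₁ * (W.b1 x * v0 x + W.b0 x * v1 x)
              - σ * W.b1 x * (vt x - σ₁ * (W.b0 x * v0 x))))
          + 3 * σ ^ 2 * σ₁ * W.b1 x ^ 3 * (e x * v0 x) ^ 2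
          + 2 * σ ^ 3 * W.b1 x ^ 3 * (e x * v0 x)
            * (e x * (vt x - σ₁ * (W.b0 x * v0 x))))
      = ∫ x in (0 : ℝ)..L, (-3 * σ₁ * W.b1 x * w1 x ^ 2 - 6 * σ * W.b1 x * w1 x * wt1 x
        + 3 * σ ^ 2 * σ₁ * W.b1 x ^ 3 * w0 x ^ 2 + 2 * σ ^ 3 * W.b1 x ^ 3 * w0 x * wt x) := by
    simp only [hw0, hw1, hwt, hwt1]
  rw [hI]
  obtain ⟨N, hN⟩ : ∃ N : ℝ → ℝ, N = fun x => w2 x ^ 2 + (σ * w1 x) ^ 2 + (σ ^ 2 * w0 x) ^ 2 :=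
    ⟨_, rfl⟩
  have cN : Continuous N := by rw [hN]; fun_prop
  have hN0 : ∀ x, 0 ≤ N x := fun x => by rw [hN]; positivity
  have hNI : 0 ≤ ∫ x in (0 : ℝ)..L, N x :=
    intervalIntegral.integral_nonneg hL.le fun x _ => hN0 x
  -- the potential term
  have hz : ∀ x ∈ Icc 0 L, (e x * v1 x) ^ 2 ≤ 10 * W.B ^ 2 / σ * ∫ y in (0 : ℝ)..L, N y := by
    intro x hx
    have := sq_le_integral_of_hasDerivAt hσ0 (z := fun x => e x * v1 x)
      (fun x => (de x).fun_mul (hv1 x)) (by fun_prop) (by simp [h10]) hx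
    refine this.trans ?_
    rw [← intervalIntegral.integral_const_mul]
    refine intervalIntegral.integral_mono_on hL.le
      (Continuous.intervalIntegrable (by fun_prop) _ _)
      (Continuous.intervalIntegrable (by fun_prop) _ _) fun y hy => ?_
    have hb1 : W.b1 y ^ 2 ≤ W.B ^ 2 := sq_le_sq.2 ((W.abs_b1 y hy).trans (le_abs_self _))
    have hb2 : W.b2 y ^ 2 ≤ W.B ^ 2 := sq_le_sq.2 ((W.abs_b2 y hy).trans (le_abs_self _))
    have e1 : e y * v1 y = w1 y + σ * W.b1 y * w0 y := by rw [hw1, hw0]; ring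
    have e2 : -(σ * W.b1 y) * e y * v1 y + e y * v2 y
        = w2 y + σ * W.b1 y * w1 y + σ * W.b2 y * w0 y := by rw [hw2, hw1, hw0]; ring
    rw [e1, e2, hN]
    beta_reduce
    have h1B : 1 ≤ W.B ^ 2 := one_le_pow₀ hB
    have hs2 : 1 ≤ σ ^ 2 := one_le_pow₀ hσ
    rw [show σ * (w1 y + σ * W.b1 y * w0 y) ^ 2 + (w2 y + σ * W.b1 y * w1 y
      + σ * W.b2 y * w0 y) ^ 2 / σ = ((σ * w1 y + W.b1 y * (σ ^ 2 * w0 y)) ^ 2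
        + (w2 y + W.b1 y * (σ * w1 y) + σ * W.b2 y * w0 y) ^ 2) / σ by field_simp]
    rw [div_mul_eq_mul_div]
    refine div_le_div_of_nonneg_right ?_ hσ0.le
    have hZ : (σ * W.b2 y * w0 y) ^ 2 ≤ W.B ^ 2 * (σ ^ 2 * w0 y) ^ 2 := by
      calc (σ * W.b2 y * w0 y) ^ 2 = W.b2 y ^ 2 * (σ ^ 2 * 1 * w0 y ^ 2) := by ring
        _ ≤ W.B ^ 2 * (σ ^ 2 * σ ^ 2 * w0 y ^ 2) := by gcongr
        _ = _ := by ring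
    generalize σ * W.b2 y * w0 y = U at hZ ⊢
    generalize σ ^ 2 * w0 y = Z at hZ ⊢
    generalize σ * w1 y = Y
    generalize w2 y = X
    generalize W.b1 y = p at hb1 ⊢
    have i1 : (Y + p * Z) ^ 2 ≤ 2 * (Y ^ 2 + p ^ 2 * Z ^ 2) := by nlinarith [sq_nonneg (Y - p * Z)]
    have i2 : (X + p * Y + U) ^ 2 ≤ 3 * (X ^ 2 + p ^ 2 * Y ^ 2 + U ^ 2) := by
      nlinarith [sq_nonneg (X - p * Y), sq_nonneg (X - U), sq_nonneg (p * Y - U)]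
    have a1 := mul_le_mul_of_nonneg_right hb1 (sq_nonneg Y)
    have a2 := mul_le_mul_of_nonneg_right hb1 (sq_nonneg Z)
    have a3 := mul_le_mul_of_nonneg_right h1B (sq_nonneg Y)
    have a4 := mul_le_mul_of_nonneg_right h1B (sq_nonneg X)
    have a5 : 0 ≤ W.B ^ 2 * X ^ 2 := by positivity
    have a6 : 0 ≤ W.B ^ 2 * Y ^ 2 := by positivity
    have a7 : 0 ≤ W.B ^ 2 * Z ^ 2 := by positivity
    linarith
  have hM0 : 0 ≤ 10 * W.B ^ 2 / σ * ∫ y in (0 : ℝ)..L, N y := by positivity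
  have src : ∫ x in (0 : ℝ)..L, (wt x + w3 x + 3 * (σ * W.b1 x) ^ 2 * w1 x
          + 3 * (σ * W.b1 x) * (σ * W.b2 x) * w0 x + 3 * (σ * W.b1 x) * w2 x
          + 3 * (σ * W.b2 x) * w1 x + (σ * W.b1 x) ^ 3 * w0 x) ^ 2
      ≤ σ * W.c * ∫ x in (0 : ℝ)..L, N x := by
    calc _ ≤ ∫ x in (0 : ℝ)..L, (2 * (10 * W.B ^ 2 / σ * ∫ y in (0 : ℝ)..L, N y) * ξ x ^ 2
          + 8 * W.B ^ 2 * N x) := by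
          refine intervalIntegral.integral_mono_on hL.le
            (Continuous.intervalIntegrable (by fun_prop) _ _)
            (Continuous.intervalIntegrable (by fun_prop) _ _) fun x hx => ?_
          have eq : wt x + w3 x + 3 * (σ * W.b1 x) ^ 2 * w1 x
              + 3 * (σ * W.b1 x) * (σ * W.b2 x) * w0 x + 3 * (σ * W.b1 x) * w2 x
              + 3 * (σ * W.b2 x) * w1 x + (σ * W.b1 x) ^ 3 * w0 x
              = -(ξ x * (e x * v1 x)) - (σ₁ * W.b0 x + σ * W.b3 x) * w0 x := by
            rw [hw0, hw1, hw2, hw3, hwt]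
            simp only [pde x hx]
            ring
          rw [eq]
          have hr : (σ₁ * W.b0 x + σ * W.b3 x) ^ 2 ≤ (2 * W.B * σ ^ 2) ^ 2 := by
            refine sq_le_sq.2 ((abs_add_le _ _).trans ?_)
            rw [abs_mul, abs_mul, abs_of_pos hσ0,
              abs_of_nonneg (by positivity : 0 ≤ 2 * W.B * σ ^ 2)]
            have i1 : |σ₁| * |W.b0 x| ≤ σ ^ 2 * W.B :=
              mul_le_mul hσ₁ (W.abs_b0 x hx) (abs_nonneg _) (by positivity)
            have i2 : σ * |W.b3 x| ≤ σ ^ 2 * W.B :=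
              mul_le_mul (by nlinarith) (W.abs_b3 x hx) (abs_nonneg _) (by positivity)
            linarith
          have hN' : (σ ^ 2 * w0 x) ^ 2 ≤ N x := by
            rw [hN]
            nlinarith [sq_nonneg (w2 x), sq_nonneg (σ * w1 x)]
          calc (-(ξ x * (e x * v1 x)) - (σ₁ * W.b0 x + σ * W.b3 x) * w0 x) ^ 2
              ≤ 2 * ((e x * v1 x) ^ 2 * ξ x ^ 2)
                + 2 * ((σ₁ * W.b0 x + σ * W.b3 x) ^ 2 * w0 x ^ 2) := by
                nlinarith [sq_nonneg (ξ x * (e x * v1 x) - (σ₁ * W.b0 x + σ * W.b3 x) * w0 x)]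
            _ ≤ 2 * ((10 * W.B ^ 2 / σ * ∫ y in (0 : ℝ)..L, N y) * ξ x ^ 2)
                + 2 * ((2 * W.B * σ ^ 2) ^ 2 * w0 x ^ 2) := by
                gcongr
                exact hz x hx
            _ = 2 * (10 * W.B ^ 2 / σ * ∫ y in (0 : ℝ)..L, N y) * ξ x ^ 2
                + 8 * W.B ^ 2 * (σ ^ 2 * w0 x) ^ 2 := by ring
            _ ≤ _ := by gcongr
      _ = 2 * (10 * W.B ^ 2 / σ * ∫ y in (0 : ℝ)..L, N y) * (∫ x in (0 : ℝ)..L, ξ x ^ 2)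
          + 8 * W.B ^ 2 * ∫ x in (0 : ℝ)..L, N x := by
          rw [intervalIntegral.integral_add (Continuous.intervalIntegrable (by fun_prop) _ _)
            (Continuous.intervalIntegrable (by fun_prop) _ _),
            intervalIntegral.integral_const_mul, intervalIntegral.integral_const_mul]
      _ ≤ 2 * (10 * W.B ^ 2 / σ * ∫ y in (0 : ℝ)..L, N y) * R ^ 2
          + 8 * W.B ^ 2 * ∫ x in (0 : ℝ)..L, N x := by gcongr
      _ ≤ 2 * (10 * W.B ^ 2 / 1 * ∫ y in (0 : ℝ)..L, N y) * R ^ 2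
          + 8 * W.B ^ 2 * ∫ x in (0 : ℝ)..L, N x := by gcongr
      _ = (20 * R ^ 2 * W.B ^ 2 + 8 * W.B ^ 2) * ∫ x in (0 : ℝ)..L, N x := by ring
      _ ≤ _ := by gcongr
  -- comparison of the two norms
  have hpq : ∀ x ∈ Icc 0 L, |(W.b1 x) ^ 2 + W.b2 x / σ| ≤ 2 * W.B ^ 2
      ∧ |(W.b1 x) ^ 2 - W.b2 x / σ| ≤ 2 * W.B ^ 2 := by
    intro x hx
    have i1 : W.b1 x ^ 2 ≤ W.B ^ 2 := sq_le_sq.2 ((W.abs_b1 x hx).trans (le_abs_self _))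
    have i2 : |W.b2 x / σ| ≤ W.B ^ 2 := by
      rw [abs_div, abs_of_pos hσ0, div_le_iff₀ hσ0]
      nlinarith [W.abs_b2 x hx, mul_nonneg hB0.le (sub_nonneg.2 hB)]
    have i3 := abs_le.1 i2
    constructor <;> rw [abs_le] <;> constructor <;> linarith [sq_nonneg (W.b1 x), i3.1, i3.2]
  have cmp1 : ∫ x in (0 : ℝ)..L, e x ^ 2 * (v2 x ^ 2 + (σ * v1 x) ^ 2 + (σ ^ 2 * v0 x) ^ 2)
      ≤ 20 * W.B ^ 4 * ∫ x in (0 : ℝ)..L, N x := by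
    rw [← intervalIntegral.integral_const_mul]
    refine intervalIntegral.integral_mono_on hL.le
      (Continuous.intervalIntegrable (by fun_prop) _ _)
      (Continuous.intervalIntegrable (by fun_prop) _ _) fun x hx => ?_
    have := conjugation_norm_equiv hB (W.abs_b1 x hx) (hpq x hx).1
      (X := w2 x) (Y := σ * w1 x) (Z := σ ^ 2 * w0 x) (X' := e x * v2 x) (Y' := σ * (e x * v1 x))
      (by rw [hw0, hw1, hw2]; field_simp; ring) (by rw [hw0, hw1]; ring)
    rw [hN]
    refine le_trans (le_of_eq ?_) this
    rw [hw0]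
    ring
  have cmp2 : ∫ x in (0 : ℝ)..L, W.P x * N x ≤ 20 * W.B ^ 4 * ∫ x in (0 : ℝ)..L,
      W.P x * (e x ^ 2 * (v2 x ^ 2 + (σ * v1 x) ^ 2 + (σ ^ 2 * v0 x) ^ 2)) := by
    rw [← intervalIntegral.integral_const_mul]
    refine intervalIntegral.integral_mono_on hL.le
      (Continuous.intervalIntegrable (by fun_prop) _ _)
      (Continuous.intervalIntegrable (by fun_prop) _ _) fun x hx => ?_
    have := conjugation_norm_equiv hB (p := -W.b1 x) (by rw [abs_neg]; exact W.abs_b1 x hx)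
      (hpq x hx).2
      (X := e x * v2 x) (Y := σ * (e x * v1 x)) (Z := σ ^ 2 * (e x * v0 x))
      (X' := w2 x) (Y' := σ * w1 x) (by rw [hw2]; field_simp; ring) (by rw [hw1]; ring)
    have h2 : N x ≤ 20 * W.B ^ 4
        * (e x ^ 2 * (v2 x ^ 2 + (σ * v1 x) ^ 2 + (σ ^ 2 * v0 x) ^ 2)) := by
      rw [hN]
      refine le_trans (le_of_eq ?_) (this.trans (le_of_eq ?_))
      · rw [hw0]
      · ring
    calc W.P x * N x ≤ W.P x * (20 * W.B ^ 4 * (e x ^ 2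
          * (v2 x ^ 2 + (σ * v1 x) ^ 2 + (σ ^ 2 * v0 x) ^ 2))) :=
          mul_le_mul_of_nonneg_left h2 (W.P_nonneg x)
      _ = _ := by ring
  have hNeq : ∀ x, w2 x ^ 2 + (σ * w1 x) ^ 2 + (σ ^ 2 * w0 x) ^ 2 = N x := fun x => by rw [hN]
  simp only [hNeq] at est
  have k1 := mul_le_mul_of_nonneg_left cmp1
    (by positivity : 0 ≤ W.c / (20 * W.B ^ 4) * σ)
  have k1' : W.c / (20 * W.B ^ 4) * σ * (20 * W.B ^ 4 * ∫ x in (0 : ℝ)..L, N x)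
      = W.c * σ * ∫ x in (0 : ℝ)..L, N x := by field_simp
  have k2 := mul_le_mul_of_nonneg_left cmp2 (by positivity : 0 ≤ 9 * W.K * σ)
  have k3 : 0 ≤ σ * W.c * ∫ x in (0 : ℝ)..L, N x := by positivity
  linarith

open Set in
/-- The embedding `H¹(0,L) ⊂ L^∞(0,L)`. -/
theorem sq_le_sobolev {L : ℝ} (hL : 0 < L) {u u1 : ℝ → ℝ} (hu : ∀ x, HasDerivAt u (u1 x) x)
    (hu1 : Continuous u1) {x : ℝ} (hx : x ∈ Icc 0 L) :
    u x ^ 2 ≤ (1 + L) / L * ∫ y in (0 : ℝ)..L, (u y ^ 2 + u1 y ^ 2) := by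
  have cu : Continuous u := continuous_iff_continuousAt.2 fun x => (hu x).continuousAt
  have ftc : ∀ a b, ∫ y in a..b, 2 * u y * u1 y = u b ^ 2 - u a ^ 2 := fun a b =>
    intervalIntegral.integral_eq_sub_of_hasDerivAt
      (fun y _ => ((hu y).fun_pow 2).congr_deriv (by push_cast; ring))
      (Continuous.intervalIntegrable (by fun_prop) _ _)
  have mono : ∀ a b, 0 ≤ a → a ≤ b → b ≤ L →
      ∫ z in a..b, (u z ^ 2 + u1 z ^ 2) ≤ ∫ z in (0 : ℝ)..L, (u z ^ 2 + u1 z ^ 2) := by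
    intro a b ha hab hb
    refine intervalIntegral.integral_mono_interval ha hab hb
      (Filter.Eventually.of_forall fun y => ?_) (Continuous.intervalIntegrable (by fun_prop) _ _)
    show 0 ≤ u y ^ 2 + u1 y ^ 2
    positivity
  have osc : ∀ y ∈ Icc 0 L, u x ^ 2 - (∫ z in (0 : ℝ)..L, (u z ^ 2 + u1 z ^ 2)) ≤ u y ^ 2 := by
    intro y hy
    rcases le_total y x with h | h
    · have : ∫ z in y..x, 2 * u z * u1 z ≤ ∫ z in y..x, (u z ^ 2 + u1 z ^ 2) :=
        intervalIntegral.integral_mono_on h (Continuous.intervalIntegrable (by fun_prop) _ _)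
          (Continuous.intervalIntegrable (by fun_prop) _ _)
          fun z _ => two_mul_le_add_sq (u z) (u1 z)
      rw [ftc] at this
      linarith [mono y x hy.1 h hx.2]
    · have : ∫ z in x..y, -(2 * u z * u1 z) ≤ ∫ z in x..y, (u z ^ 2 + u1 z ^ 2) :=
        intervalIntegral.integral_mono_on h (Continuous.intervalIntegrable (by fun_prop) _ _)
          (Continuous.intervalIntegrable (by fun_prop) _ _)
          fun z _ => by nlinarith [sq_nonneg (u z + u1 z)]
      rw [intervalIntegral.integral_neg, ftc] at this
      linarith [mono x y hx.1 h hy.2]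
  have int := intervalIntegral.integral_mono_on hL.le
    (intervalIntegrable_const (μ := MeasureTheory.volume))
    (Continuous.intervalIntegrable (by fun_prop) _ _) osc
  have split : ∫ y in (0 : ℝ)..L, u y ^ 2 ≤ ∫ y in (0 : ℝ)..L, (u y ^ 2 + u1 y ^ 2) :=
    intervalIntegral.integral_mono_on hL.le (Continuous.intervalIntegrable (by fun_prop) _ _)
      (Continuous.intervalIntegrable (by fun_prop) _ _)
      fun z _ => le_add_of_nonneg_right (sq_nonneg _)
  rw [intervalIntegral.integral_const, smul_eq_mul, sub_zero] at int
  rw [div_mul_eq_mul_div, le_div_iff₀ hL]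
  linarith

open Set in
/-- A Hardy type bound for a function vanishing at the left end point. -/
theorem cube_mul_sq_le_integral {L : ℝ} {u u1 : ℝ → ℝ} (hu : ∀ x, HasDerivAt u (u1 x) x)
    (hu1 : Continuous u1) (h0 : u 0 = 0) {x : ℝ} (hx : x ∈ Icc 0 L) :
    (L - x) ^ 3 * u x ^ 2 ≤ L * ∫ y in (0 : ℝ)..L, (L - y) ^ 3 * u1 y ^ 2 := by
  have hxL : 0 ≤ L - x := by linarith [hx.2]
  have hL : 0 ≤ L := hx.1.trans hx.2
  have ftc : ∫ y in (0 : ℝ)..x, u1 y = u x := by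
    rw [intervalIntegral.integral_eq_sub_of_hasDerivAt (fun y _ => hu y)
      (Continuous.intervalIntegrable (by fun_prop) _ _), h0, sub_zero]
  have cs : u x ^ 2 ≤ x * ∫ y in (0 : ℝ)..x, u1 y ^ 2 := by
    rcases hx.1.eq_or_lt with h | h
    · rw [← h, h0]; simp
    · have : 0 ≤ ∫ y in (0 : ℝ)..x, (u1 y ^ 2 - 2 * (u x / x) * u1 y + (u x / x) ^ 2) :=
        intervalIntegral.integral_nonneg hx.1 fun y _ => by nlinarith [sq_nonneg (u1 y - u x / x)]
      rw [intervalIntegral.integral_add (Continuous.intervalIntegrable (by fun_prop) _ _)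
          (Continuous.intervalIntegrable (by fun_prop) _ _),
        intervalIntegral.integral_sub (Continuous.intervalIntegrable (by fun_prop) _ _)
          (Continuous.intervalIntegrable (by fun_prop) _ _),
        intervalIntegral.integral_const_mul, ftc, intervalIntegral.integral_const, smul_eq_mul,
        sub_zero] at this
      have e : (∫ y in (0 : ℝ)..x, u1 y ^ 2) - 2 * (u x / x) * u x + x * (u x / x) ^ 2
          = (∫ y in (0 : ℝ)..x, u1 y ^ 2) - u x ^ 2 / x := by
        field_simp; ring
      rw [e, sub_nonneg, div_le_iff₀ h] at this
      linarith
  have step : (L - x) ^ 3 * ∫ y in (0 : ℝ)..x, u1 y ^ 2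
      ≤ ∫ y in (0 : ℝ)..L, (L - y) ^ 3 * u1 y ^ 2 := by
    rw [← intervalIntegral.integral_const_mul]
    calc ∫ y in (0 : ℝ)..x, (L - x) ^ 3 * u1 y ^ 2
        ≤ ∫ y in (0 : ℝ)..x, (L - y) ^ 3 * u1 y ^ 2 := by
          refine intervalIntegral.integral_mono_on hx.1
            (Continuous.intervalIntegrable (by fun_prop) _ _)
            (Continuous.intervalIntegrable (by fun_prop) _ _) fun y hy => ?_
          have := hy.2
          gcongr
      _ ≤ _ := by
          rw [← intervalIntegral.integral_add_adjacent_intervals (a := 0) (b := x) (c := L)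
            (f := fun y => (L - y) ^ 3 * u1 y ^ 2) (μ := MeasureTheory.volume)
            (Continuous.intervalIntegrable (by fun_prop) _ _)
            (Continuous.intervalIntegrable (by fun_prop) _ _)]
          refine le_add_of_nonneg_right (intervalIntegral.integral_nonneg hx.2 fun y hy => ?_)
          have : 0 ≤ L - y := by linarith [hy.2]
          positivity
  have pos : 0 ≤ ∫ y in (0 : ℝ)..x, u1 y ^ 2 :=
    intervalIntegral.integral_nonneg hx.1 fun y _ => sq_nonneg _
  calc (L - x) ^ 3 * u x ^ 2 ≤ (L - x) ^ 3 * (x * ∫ y in (0 : ℝ)..x, u1 y ^ 2) := by gcongr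
    _ = x * ((L - x) ^ 3 * ∫ y in (0 : ℝ)..x, u1 y ^ 2) := by ring
    _ ≤ L * ((L - x) ^ 3 * ∫ y in (0 : ℝ)..x, u1 y ^ 2) := by
      have := hx.2
      gcongr
    _ ≤ _ := by gcongr

open Set in
/-- Kato smoothing at the `H²` level, at a fixed time, with the weight `(L - x)³`. -/
theorem smoothing_slice_estimate {L : ℝ} (hL : 0 < L) {ξ ξ1 f1 f2 v1 v2 v3 v4 v5 vt2 : ℝ → ℝ}
    (hξ : ∀ x, HasDerivAt ξ (ξ1 x) x) (cξ1 : Continuous ξ1)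
    (hv1 : ∀ x, HasDerivAt v1 (v2 x) x) (hv2 : ∀ x, HasDerivAt v2 (v3 x) x)
    (hv3 : ∀ x, HasDerivAt v3 (v4 x) x) (hv4 : ∀ x, HasDerivAt v4 (v5 x) x) (cv5 : Continuous v5)
    (hf1 : ∀ x, f1 x = ξ1 x * v1 x + ξ x * v2 x) (df1 : ∀ x, HasDerivAt f1 (f2 x) x)
    (cf2 : Continuous f2)
    (pde : ∀ x ∈ Icc 0 L, vt2 x = -f2 x - v5 x) (h1 : v1 0 = 0) (h3 : v3 0 = 0)
    (h4 : v4 0 + f1 0 = 0) :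
    8 * (∫ x in (0 : ℝ)..L, (L - x) ^ 2 * v3 x ^ 2) ≤
      (∫ x in (0 : ℝ)..L, (L - x) ^ 3 * (2 * v2 x * vt2 x))
      + (6 + 9 * L) * (∫ x in (0 : ℝ)..L, v2 x ^ 2)
      + 2 * (L + 1) * (L + (1 + L) / L) * (∫ x in (0 : ℝ)..L, (ξ x ^ 2 + ξ1 x ^ 2))
        * ∫ x in (0 : ℝ)..L, (L - x) ^ 3 * v2 x ^ 2 := by
  have cξ : Continuous ξ := continuous_iff_continuousAt.2 fun x => (hξ x).continuousAt
  have cv1 : Continuous v1 := continuous_iff_continuousAt.2 fun x => (hv1 x).continuousAt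
  have cv2 : Continuous v2 := continuous_iff_continuousAt.2 fun x => (hv2 x).continuousAt
  have cv3 : Continuous v3 := continuous_iff_continuousAt.2 fun x => (hv3 x).continuousAt
  have cv4 : Continuous v4 := continuous_iff_continuousAt.2 fun x => (hv4 x).continuousAt
  have cf1 : Continuous f1 := continuous_iff_continuousAt.2 fun x => (df1 x).continuousAt
  have hr : ∀ x : ℝ, HasDerivAt (fun x => L - x) (-1) x := fun x => (hasDerivAt_id x).const_sub L
  have key : ∀ x, HasDerivAt (fun x => -2 * ((L - x) ^ 3 * (v2 x * (v4 x + f1 x)))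
      - 6 * ((L - x) ^ 2 * (v2 x * v3 x)) + (L - x) ^ 3 * v3 x ^ 2 - 6 * ((L - x) * v2 x ^ 2))
      ((L - x) ^ 3 * (2 * v2 x * (-f2 x - v5 x)) - (9 * ((L - x) ^ 2 * v3 x ^ 2) - 6 * v2 x ^ 2
        + 2 * ((L - x) ^ 3 * v3 x - 3 * (L - x) ^ 2 * v2 x) * f1 x)) x := by
    intro x
    have := (((((hr x).fun_pow 3).fun_mul ((hv2 x).fun_mul ((hv4 x).fun_add (df1 x)))).const_mul
      (-2)).fun_sub ((((hr x).fun_pow 2).fun_mul ((hv2 x).fun_mul (hv3 x))).const_mul 6)).fun_add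
      (((hr x).fun_pow 3).fun_mul ((hv3 x).fun_pow 2))
    have := this.fun_sub (((hr x).fun_mul ((hv2 x).fun_pow 2)).const_mul 6)
    refine this.congr_deriv ?_
    push_cast
    ring
  have ftc := intervalIntegral.integral_eq_sub_of_hasDerivAt (a := 0) (b := L) (fun x _ => key x)
    (Continuous.intervalIntegrable (by fun_prop) _ _)
  rw [intervalIntegral.integral_sub (Continuous.intervalIntegrable (by fun_prop) _ _)
    (Continuous.intervalIntegrable (by fun_prop) _ _), h3, h4] at ftc
  have e1 : ∫ x in (0 : ℝ)..L, (L - x) ^ 3 * (2 * v2 x * (-f2 x - v5 x))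
      = ∫ x in (0 : ℝ)..L, (L - x) ^ 3 * (2 * v2 x * vt2 x) := by
    refine intervalIntegral.integral_congr fun x hx => ?_
    rw [uIcc_of_le hL.le] at hx
    simp only [pde x hx]
  rw [e1] at ftc
  obtain ⟨g, hg⟩ : ∃ g, g = ∫ x in (0 : ℝ)..L, (ξ x ^ 2 + ξ1 x ^ 2) := ⟨_, rfl⟩
  obtain ⟨Y, hY⟩ : ∃ Y, Y = ∫ x in (0 : ℝ)..L, (L - x) ^ 3 * v2 x ^ 2 := ⟨_, rfl⟩
  have hY0 : 0 ≤ Y := by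
    rw [hY]
    refine intervalIntegral.integral_nonneg hL.le fun x hx => ?_
    have : 0 ≤ L - x := by linarith [hx.2]
    positivity
  have lower : ∫ x in (0 : ℝ)..L, (8 * ((L - x) ^ 2 * v3 x ^ 2) - (6 + 9 * L) * v2 x ^ 2
        - (2 * (L + 1) * (L * Y) * ξ1 x ^ 2
          + 2 * (L + 1) * ((1 + L) / L * g) * ((L - x) ^ 3 * v2 x ^ 2)))
      ≤ ∫ x in (0 : ℝ)..L, (9 * ((L - x) ^ 2 * v3 x ^ 2) - 6 * v2 x ^ 2
        + 2 * ((L - x) ^ 3 * v3 x - 3 * (L - x) ^ 2 * v2 x) * f1 x) := by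
    refine intervalIntegral.integral_mono_on hL.le
      (Continuous.intervalIntegrable (by fun_prop) _ _)
      (Continuous.intervalIntegrable (by fun_prop) _ _) fun x hx => ?_
    have hx0 : 0 ≤ L - x := by linarith [hx.2]
    have hxL : L - x ≤ L := by linarith [hx.1]
    have s1 : (L - x) ^ 3 * v1 x ^ 2 ≤ L * Y := hY ▸ cube_mul_sq_le_integral hv1 cv2 h1 hx
    have s2 : ξ x ^ 2 ≤ (1 + L) / L * g := hg ▸ sq_le_sobolev hL hξ cξ1 hx
    have hq : (L - x) ^ 3 * f1 x ^ 2 ≤ 2 * ((L * Y) * ξ1 x ^ 2)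
        + 2 * (((1 + L) / L * g) * ((L - x) ^ 3 * v2 x ^ 2)) := by
      calc (L - x) ^ 3 * f1 x ^ 2
          ≤ (L - x) ^ 3 * (2 * (ξ1 x ^ 2 * v1 x ^ 2) + 2 * (ξ x ^ 2 * v2 x ^ 2)) := by
            gcongr
            rw [hf1]
            nlinarith [sq_nonneg (ξ1 x * v1 x - ξ x * v2 x)]
        _ = 2 * (((L - x) ^ 3 * v1 x ^ 2) * ξ1 x ^ 2)
            + 2 * (ξ x ^ 2 * ((L - x) ^ 3 * v2 x ^ 2)) := by ring
        _ ≤ _ := by gcongr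
    have t1 : -((L - x) ^ 2 * v3 x ^ 2) - L * ((L - x) ^ 3 * f1 x ^ 2)
        ≤ 2 * ((L - x) ^ 3 * v3 x) * f1 x := by
      have : 0 ≤ (L - x) ^ 2 * (v3 x + (L - x) * f1 x) ^ 2 := by positivity
      have : (L - x) * ((L - x) ^ 3 * f1 x ^ 2) ≤ L * ((L - x) ^ 3 * f1 x ^ 2) := by gcongr
      linarith
    have t2 : -(9 * L * v2 x ^ 2) - (L - x) ^ 3 * f1 x ^ 2
        ≤ 2 * (-3 * (L - x) ^ 2 * v2 x) * f1 x := by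
      have : 0 ≤ (L - x) * (3 * v2 x - (L - x) * f1 x) ^ 2 := by positivity
      have : (L - x) * v2 x ^ 2 ≤ L * v2 x ^ 2 := by gcongr
      linarith
    have t3 := mul_le_mul_of_nonneg_left hq (by linarith : 0 ≤ L + 1)
    linarith
  rw [intervalIntegral.integral_sub (Continuous.intervalIntegrable (by fun_prop) _ _)
      (Continuous.intervalIntegrable (by fun_prop) _ _),
    intervalIntegral.integral_sub (Continuous.intervalIntegrable (by fun_prop) _ _)
      (Continuous.intervalIntegrable (by fun_prop) _ _),
    intervalIntegral.integral_add (Continuous.intervalIntegrable (by fun_prop) _ _)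
      (Continuous.intervalIntegrable (by fun_prop) _ _),
    intervalIntegral.integral_const_mul, intervalIntegral.integral_const_mul,
    intervalIntegral.integral_const_mul, intervalIntegral.integral_const_mul, ← hY] at lower
  have hξ1g : ∫ x in (0 : ℝ)..L, ξ1 x ^ 2 ≤ g := by
    rw [hg]
    exact intervalIntegral.integral_mono_on hL.le (Continuous.intervalIntegrable (by fun_prop) _ _)
      (Continuous.intervalIntegrable (by fun_prop) _ _)
      fun z _ => le_add_of_nonneg_left (sq_nonneg _)
  have t4 := mul_le_mul_of_nonneg_left hξ1g (by positivity : 0 ≤ 2 * (L + 1) * (L * Y))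
  have t5 : 0 ≤ 6 * (L * v2 0 ^ 2) := by positivity
  rw [← hg, ← hY]
  simp only [sub_self, sub_zero] at ftc
  linarith

open Set in
/-- One step of interpolation on an interval with a weight vanishing at both ends. -/
theorem integral_weighted_sq_deriv_le {l1 l2 : ℝ} (hl : l1 < l2) (p : ℕ) {a : ℝ} (ha : 0 < a)
    (ha1 : a ≤ 1) {u0 u1 u2 : ℝ → ℝ} (hu0 : ∀ x, HasDerivAt u0 (u1 x) x)
    (hu1 : ∀ x, HasDerivAt u1 (u2 x) x) (hu2 : Continuous u2) :
    ∫ x in l1..l2, ((x - l1) * (l2 - x)) ^ (2 * p + 2) * u1 x ^ 2 ≤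
      2 * a * (∫ x in l1..l2, ((x - l1) * (l2 - x)) ^ (2 * p + 4) * u2 x ^ 2)
      + (1 / 2 + (2 * p + 2) ^ 2 * (l2 - l1) ^ 2) / a
        * ∫ x in l1..l2, ((x - l1) * (l2 - x)) ^ (2 * p) * u0 x ^ 2 := by
  have c0 : Continuous u0 := continuous_iff_continuousAt.2 fun x => (hu0 x).continuousAt
  have c1 : Continuous u1 := continuous_iff_continuousAt.2 fun x => (hu1 x).continuousAt
  have hρ : ∀ x, HasDerivAt (fun x => (x - l1) * (l2 - x)) (l1 + l2 - 2 * x) x := fun x =>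
    (((hasDerivAt_id x).sub_const l1).fun_mul ((hasDerivAt_id x).const_sub l2)).congr_deriv
      (by simp only [id]; ring)
  have key : ∀ x, HasDerivAt (fun x => ((x - l1) * (l2 - x)) ^ (2 * p + 2) * (u1 x * u0 x))
      ((2 * p + 2) * ((x - l1) * (l2 - x)) ^ (2 * p + 1) * (l1 + l2 - 2 * x) * (u1 x * u0 x)
        + ((x - l1) * (l2 - x)) ^ (2 * p + 2) * (u2 x * u0 x + u1 x ^ 2)) x := fun x =>
    (((hρ x).fun_pow (2 * p + 2)).fun_mul ((hu1 x).fun_mul (hu0 x))).congr_deriv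
      (by push_cast; ring_nf)
  have ftc := intervalIntegral.integral_eq_sub_of_hasDerivAt (a := l1) (b := l2)
    (fun x _ => key x) (Continuous.intervalIntegrable (by fun_prop) _ _)
  simp only [sub_self, zero_mul, mul_zero, ne_eq, Nat.add_eq_zero_iff, OfNat.ofNat_ne_zero,
    and_false, not_false_eq_true, zero_pow] at ftc
  have low : ∫ x in l1..l2, (1 / 2 * (((x - l1) * (l2 - x)) ^ (2 * p + 2) * u1 x ^ 2)
        - a * (((x - l1) * (l2 - x)) ^ (2 * p + 4) * u2 x ^ 2)
        - (1 / 2 + (2 * p + 2) ^ 2 * (l2 - l1) ^ 2) / (2 * a)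
          * (((x - l1) * (l2 - x)) ^ (2 * p) * u0 x ^ 2))
      ≤ ∫ x in l1..l2,
        ((2 * p + 2) * ((x - l1) * (l2 - x)) ^ (2 * p + 1) * (l1 + l2 - 2 * x) * (u1 x * u0 x)
        + ((x - l1) * (l2 - x)) ^ (2 * p + 2) * (u2 x * u0 x + u1 x ^ 2)) := by
    refine intervalIntegral.integral_mono_on hl.le
      (Continuous.intervalIntegrable (by fun_prop) _ _)
      (Continuous.intervalIntegrable (by fun_prop) _ _) fun x hx => ?_
    obtain ⟨r, hr⟩ : ∃ r, r = (x - l1) * (l2 - x) := ⟨_, rfl⟩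
    obtain ⟨r', hr'⟩ : ∃ r', r' = l1 + l2 - 2 * x := ⟨_, rfl⟩
    have hr'l : r' ^ 2 ≤ (l2 - l1) ^ 2 := by
      rw [hr']
      exact sq_le_sq' (by linarith [hx.2]) (by linarith [hx.1])
    rw [← hr, ← hr']
    have e4 : r ^ (2 * p + 4) = (r ^ p * r ^ 2) ^ 2 := by ring
    have e2 : r ^ (2 * p + 2) = (r ^ p * r) ^ 2 := by ring
    have e1 : r ^ (2 * p + 1) = r ^ p * r * r ^ p := by ring
    have e0 : r ^ (2 * p) = (r ^ p) ^ 2 := by ring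
    rw [e4, e2, e1, e0]
    obtain ⟨q, hq⟩ : ∃ q, q = r ^ p := ⟨_, rfl⟩
    rw [← hq]
    have s1 : 0 ≤ a * (q * r ^ 2 * u2 x + q * u0 x / (2 * a)) ^ 2 := by positivity
    have s1' : a * (q * r ^ 2 * u2 x + q * u0 x / (2 * a)) ^ 2
        = a * ((q * r ^ 2) ^ 2 * u2 x ^ 2) + (q * r) ^ 2 * (u2 x * u0 x)
          + 1 / 2 / (2 * a) * (q ^ 2 * u0 x ^ 2) := by
      field_simp; ring
    have s2 : 0 ≤ (q * r * u1 x + (2 * p + 2) * r' * (q * u0 x)) ^ 2 := sq_nonneg _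
    have s3 : (2 * p + 2) ^ 2 * r' ^ 2 * (q ^ 2 * u0 x ^ 2)
        ≤ ((2 * p + 2) ^ 2 * (l2 - l1) ^ 2) * (q ^ 2 * u0 x ^ 2) := by gcongr
    have s4 : ((2 * p + 2) ^ 2 * (l2 - l1) ^ 2) * (q ^ 2 * u0 x ^ 2)
        ≤ ((2 * p + 2) ^ 2 * (l2 - l1) ^ 2) / a * (q ^ 2 * u0 x ^ 2) := by
      gcongr
      exact le_div_self (by positivity) ha ha1
    have s5 : (1 / 2 + (2 * p + 2) ^ 2 * (l2 - l1) ^ 2) / (2 * a) * (q ^ 2 * u0 x ^ 2)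
        = 1 / 2 / (2 * a) * (q ^ 2 * u0 x ^ 2)
          + 1 / 2 * (((2 * p + 2) ^ 2 * (l2 - l1) ^ 2) / a * (q ^ 2 * u0 x ^ 2)) := by
      field_simp
    rw [s5]
    linarith
  rw [ftc, intervalIntegral.integral_sub (Continuous.intervalIntegrable (by fun_prop) _ _)
      (Continuous.intervalIntegrable (by fun_prop) _ _),
    intervalIntegral.integral_sub (Continuous.intervalIntegrable (by fun_prop) _ _)
      (Continuous.intervalIntegrable (by fun_prop) _ _),
    intervalIntegral.integral_const_mul, intervalIntegral.integral_const_mul,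
    intervalIntegral.integral_const_mul] at low
  have e : (1 / 2 + (2 * p + 2) ^ 2 * (l2 - l1) ^ 2) / (2 * a)
      = (1 / 2 + (2 * p + 2) ^ 2 * (l2 - l1) ^ 2) / a / 2 := by
    field_simp
  rw [e] at low
  linarith

/-- Interior interpolation of the first two derivatives between the third one and the function. -/
theorem exists_interpolation_const {l1 l2 : ℝ} (hl : l1 < l2) :
    ∃ K, 0 < K ∧ ∀ a, 0 < a → a ≤ 1 → ∀ v0 v1 v2 v3 : ℝ → ℝ,
      (∀ x, HasDerivAt v0 (v1 x) x) → (∀ x, HasDerivAt v1 (v2 x) x) →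
      (∀ x, HasDerivAt v2 (v3 x) x) → Continuous v3 →
      (∫ x in l1..l2, ((x - l1) * (l2 - x)) ^ 2 * v1 x ^ 2)
        + (∫ x in l1..l2, ((x - l1) * (l2 - x)) ^ 4 * v2 x ^ 2)
      ≤ a * (∫ x in l1..l2, ((x - l1) * (l2 - x)) ^ 6 * v3 x ^ 2)
        + K / a ^ 2 * ∫ x in l1..l2, v0 x ^ 2 := by
  obtain ⟨K0, hK0⟩ : ∃ K0, K0 = 1 / 2 + (2 * ((0 : ℕ) : ℝ) + 2) ^ 2 * (l2 - l1) ^ 2 := ⟨_, rfl⟩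
  obtain ⟨K1, hK1⟩ : ∃ K1, K1 = 1 / 2 + (2 * ((1 : ℕ) : ℝ) + 2) ^ 2 * (l2 - l1) ^ 2 := ⟨_, rfl⟩
  have k0 : 1 / 2 ≤ K0 := hK0 ▸ le_add_of_nonneg_right (by positivity)
  have k1 : 1 / 2 ≤ K1 := hK1 ▸ le_add_of_nonneg_right (by positivity)
  have p0 : 0 < K0 := by linarith
  have p1 : 0 < K1 := by linarith
  refine ⟨64 * (16 * K0 * K1 ^ 2 + 4 * K0 * K1), by positivity, ?_⟩
  intro a ha ha1 v0 v1 v2 v3 h0 h1 h2 c3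
  have c2 : Continuous v2 := continuous_iff_continuousAt.2 fun x => (h2 x).continuousAt
  have i1 := integral_weighted_sq_deriv_le hl 0 (a := a / 8 / (4 * K1)) (by positivity)
    ((div_le_one (by positivity)).2 (by linarith)) h0 h1 c2
  have i2 := integral_weighted_sq_deriv_le hl 1 (a := a / 8) (by positivity) (by linarith) h1 h2 c3
  rw [← hK0] at i1
  rw [← hK1] at i2
  simp only [mul_zero, zero_add, pow_zero, one_mul, mul_one, Nat.reduceAdd] at i1 i2
  have nn : ∀ f : ℝ → ℝ, (∀ x, 0 ≤ f x) → 0 ≤ ∫ x in l1..l2, f x := fun f hf =>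
    intervalIntegral.integral_nonneg hl.le fun x _ => hf x
  have n0 := nn (fun x => v0 x ^ 2) fun x => sq_nonneg _
  have n2 := nn (fun x => ((x - l1) * (l2 - x)) ^ 4 * v2 x ^ 2) fun x => by positivity
  generalize (∫ x in l1..l2, v0 x ^ 2) = I0 at *
  generalize (∫ x in l1..l2, ((x - l1) * (l2 - x)) ^ 2 * v1 x ^ 2) = I1 at *
  generalize (∫ x in l1..l2, ((x - l1) * (l2 - x)) ^ 4 * v2 x ^ 2) = I2 at *
  generalize (∫ x in l1..l2, ((x - l1) * (l2 - x)) ^ 6 * v3 x ^ 2) = I3 at *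
  have j1 : K1 / (a / 8) * I1
      ≤ K1 / (a / 8) * (2 * (a / 8 / (4 * K1)) * I2 + K0 / (a / 8 / (4 * K1)) * I0) := by
    gcongr
  have j1' : K1 / (a / 8) * (2 * (a / 8 / (4 * K1)) * I2 + K0 / (a / 8 / (4 * K1)) * I0)
      = I2 / 2 + 64 * (4 * K0 * K1 ^ 2) / a ^ 2 * I0 := by
    field_simp; ring
  have j2 : 2 * (a / 8 / (4 * K1)) * I2 ≤ 1 * I2 := by
    gcongr
    rw [← mul_div_assoc, div_le_one (by positivity)]
    linarith
  have j3 : K0 / (a / 8 / (4 * K1)) * I0 ≤ 64 * (4 * K0 * K1) / a ^ 2 * I0 := by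
    refine mul_le_mul_of_nonneg_right ?_ n0
    have e : K0 / (a / 8 / (4 * K1)) = 32 * (K0 * K1) * a / a ^ 2 := by field_simp; ring
    rw [e]
    refine div_le_div_of_nonneg_right ?_ (sq_nonneg a)
    have : K0 * K1 * a ≤ K0 * K1 * 1 := by gcongr
    linarith [mul_pos p0 p1]
  have e : 64 * (16 * K0 * K1 ^ 2 + 4 * K0 * K1) / a ^ 2 * I0
      = 4 * (64 * (4 * K0 * K1 ^ 2) / a ^ 2 * I0) + 64 * (4 * K0 * K1) / a ^ 2 * I0 := by ring
  rw [e]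
  linarith

open Set in
theorem exists_sub_mul_le_of_pos_on_zeros {F P : ℝ → ℝ} {a b : ℝ} (hF : ContinuousOn F (Icc a b))
    (hP : ContinuousOn P (Icc a b)) (hP0 : ∀ x ∈ Icc a b, 0 ≤ P x)
    (h : ∀ x ∈ Icc a b, P x = 0 → 0 < F x) :
    ∃ c K : ℝ, 0 < c ∧ 0 ≤ K ∧ ∀ x ∈ Icc a b, c - K * P x ≤ F x := by
  obtain ⟨B, hB⟩ := isCompact_Icc.exists_bound_of_continuousOn hF
  have hS : IsCompact {x ∈ Icc a b | F x ≤ 0} :=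
    isCompact_Icc.of_isClosed_subset
      (hF.preimage_isClosed_of_isClosed isClosed_Icc (isClosed_Iic (a := 0))) fun x hx => hx.1
  have hPS : ∀ x ∈ {x ∈ Icc a b | F x ≤ 0}, 0 < P x := fun x hx =>
    (hP0 x hx.1).lt_of_ne fun e => (h x hx.1 e.symm).not_ge hx.2
  obtain ⟨p, hp, hpS⟩ := hS.exists_forall_le' (hP.mono fun x hx => hx.1) hPS
  have hpos : ∀ x ∈ Icc a b, 0 < F x + (|B| + 1) / p * P x := by
    intro x hx
    by_cases hxF : F x ≤ 0
    · have h1 : (|B| + 1) / p * p ≤ (|B| + 1) / p * P x := by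
        gcongr
        exact hpS x ⟨hx, hxF⟩
      rw [div_mul_cancel₀ _ hp.ne'] at h1
      have h2 := abs_le.1 ((Real.norm_eq_abs (F x)) ▸ hB x hx)
      linarith [le_abs_self B]
    · have := mul_nonneg (by positivity : 0 ≤ (|B| + 1) / p) (hP0 x hx)
      linarith
  obtain ⟨c, hc, hcS⟩ := isCompact_Icc.exists_forall_le'
    (hF.add (continuousOn_const.mul hP)) hpos
  exact ⟨c, (|B| + 1) / p, hc, by positivity, fun x hx => sub_le_iff_le_add.2 (hcS x hx)⟩

open Set in
theorem exists_carlemanWeight {L l1 l2 : ℝ} {ψ : ℝ → ℝ} (hψ : ContDiff ℝ 3 ψ)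
    (hψ' : ∀ x ∈ Icc 0 L, x ∉ Ioo l1 l2 → deriv ψ x ≠ 0 ∧ deriv (deriv ψ) x < 0)
    (h0 : deriv ψ 0 < 0) (hL : 0 < deriv ψ L) (m : ℝ) {δ : ℝ} (hδ : 0 < δ) :
    ∃ W : CarlemanWeight L, W.b0 = (fun x => m + δ * ψ x) ∧
      W.P = fun x => max 0 ((x - l1) * (l2 - x)) ^ 4 := by
  have s1 : ContDiff ℝ 2 (deriv ψ) := (contDiff_succ_iff_deriv.1 hψ).2.2
  have s2 : ContDiff ℝ 1 (deriv (deriv ψ)) := (contDiff_succ_iff_deriv.1 s1).2.2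
  have s3 : ContDiff ℝ 0 (deriv (deriv (deriv ψ))) := (contDiff_succ_iff_deriv.1 s2).2.2
  have d0 : ∀ x, HasDerivAt (fun x => m + δ * ψ x) (δ * deriv ψ x) x := fun x =>
    (((hψ.differentiable (by simp)) x).hasDerivAt.const_mul δ).const_add m
  have d1 : ∀ x, HasDerivAt (fun x => δ * deriv ψ x) (δ * deriv (deriv ψ) x) x := fun x =>
    ((s1.differentiable (by simp)) x).hasDerivAt.const_mul δ
  have d2 : ∀ x, HasDerivAt (fun x => δ * deriv (deriv ψ) x) (δ * deriv (deriv (deriv ψ)) x) x :=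
    fun x => ((s2.differentiable (by simp)) x).hasDerivAt.const_mul δ
  have c0 := hψ.continuous
  have c1 := s1.continuous
  have c2 := s2.continuous
  have c3 := s3.continuous
  have cP : Continuous fun x => max 0 ((x - l1) * (l2 - x)) ^ 4 := by fun_prop
  obtain ⟨c, K, hc, hK, hcK⟩ := exists_sub_mul_le_of_pos_on_zeros (a := 0) (b := L)
    (F := fun x => min (-(δ * deriv (deriv ψ) x))
      (min (-2 * (δ * deriv ψ x) ^ 2 * (δ * deriv (deriv ψ) x))
        (-(δ * deriv ψ x) ^ 4 * (δ * deriv (deriv ψ) x))))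
    (Continuous.continuousOn (by fun_prop)) cP.continuousOn
    (fun x _ => by positivity) (by
      intro x hx hPx
      have hxω : x ∉ Ioo l1 l2 := fun h => by
        have : 0 < (x - l1) * (l2 - x) := mul_pos (by linarith [h.1]) (by linarith [h.2])
        simp only [max_eq_right this.le] at hPx
        exact (pow_pos this 4).ne' hPx
      obtain ⟨n1, n2⟩ := hψ' x hx hxω
      have n2' : 0 < -(δ * deriv (deriv ψ) x) := by
        rw [← mul_neg]; exact mul_pos hδ (by linarith)
      have n1' : 0 < (δ * deriv ψ x) ^ 2 := by positivity
      have n1'' : 0 < (δ * deriv ψ x) ^ 4 := by positivity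
      refine lt_min n2' (lt_min ?_ ?_)
      · linarith [mul_pos n1' n2']
      · linarith [mul_pos n1'' n2'])
  obtain ⟨B0, hB0⟩ := (isCompact_Icc (a := 0) (b := L)).exists_bound_of_continuousOn
    (f := fun x => m + δ * ψ x) (Continuous.continuousOn (by fun_prop))
  obtain ⟨B1, hB1⟩ := (isCompact_Icc (a := 0) (b := L)).exists_bound_of_continuousOn
    (f := fun x => δ * deriv ψ x) (Continuous.continuousOn (by fun_prop))
  obtain ⟨B2, hB2⟩ := (isCompact_Icc (a := 0) (b := L)).exists_bound_of_continuousOn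
    (f := fun x => δ * deriv (deriv ψ) x) (Continuous.continuousOn (by fun_prop))
  obtain ⟨B3, hB3⟩ := (isCompact_Icc (a := 0) (b := L)).exists_bound_of_continuousOn
    (f := fun x => δ * deriv (deriv (deriv ψ)) x) (Continuous.continuousOn (by fun_prop))
  have a0 := abs_nonneg B0
  have a1 := abs_nonneg B1
  have a2 := abs_nonneg B2
  have a3 := abs_nonneg B3
  refine ⟨{ b0 := fun x => m + δ * ψ x, b1 := fun x => δ * deriv ψ x
            b2 := fun x => δ * deriv (deriv ψ) x, b3 := fun x => δ * deriv (deriv (deriv ψ)) x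
            P := fun x => max 0 ((x - l1) * (l2 - x)) ^ 4
            c := c, K := K, B := 1 + |B0| + |B1| + |B2| + |B3|
            d0 := d0, d1 := d1, d2 := d2, cont3 := by fun_prop, contP := cP
            P_nonneg := fun x => by positivity
            c_pos := hc, K_nonneg := hK, one_le_B := by linarith
            abs_b0 := fun x hx => ((hB0 x hx).trans (le_abs_self B0)).trans (by linarith)
            abs_b1 := fun x hx => ((hB1 x hx).trans (le_abs_self B1)).trans (by linarith)
            abs_b2 := fun x hx => ((hB2 x hx).trans (le_abs_self B2)).trans (by linarith)
            abs_b3 := fun x hx => ((hB3 x hx).trans (le_abs_self B3)).trans (by linarith)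
            conv2 := fun x hx => (hcK x hx).trans (min_le_left _ _)
            conv1 := fun x hx => (hcK x hx).trans ((min_le_right _ _).trans (min_le_left _ _))
            conv0 := fun x hx => (hcK x hx).trans ((min_le_right _ _).trans (min_le_right _ _))
            left_neg := mul_neg_of_pos_of_neg hδ h0
            right_pos := mul_pos hδ hL }, rfl, rfl⟩

open Set in
/-- The observation term of the Carleman estimate is controlled by weighted integrals on the
observation window. -/
theorem integral_bump_mul_le {L l1 l2 m σ : ℝ} (hl1 : 0 ≤ l1) (hl : l1 ≤ l2) (hl2 : l2 ≤ L)
    (hσ : 1 ≤ σ) {b v0 v1 v2 : ℝ → ℝ} (cb : Continuous b) (hb : ∀ x ∈ Icc 0 L, m ≤ b x)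
    (c0 : Continuous v0) (c1 : Continuous v1) (c2 : Continuous v2) :
    ∫ x in (0 : ℝ)..L, max 0 ((x - l1) * (l2 - x)) ^ 4
        * (Real.exp (-(σ * b x)) ^ 2 * (v2 x ^ 2 + (σ * v1 x) ^ 2 + (σ ^ 2 * v0 x) ^ 2)) ≤
      (1 + ((l2 - l1) ^ 2) ^ 2 + ((l2 - l1) ^ 2) ^ 4) * σ ^ 4 * Real.exp (-(2 * m * σ))
        * ((∫ x in l1..l2, v0 x ^ 2)
          + ((∫ x in l1..l2, ((x - l1) * (l2 - x)) ^ 2 * v1 x ^ 2)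
            + ∫ x in l1..l2, ((x - l1) * (l2 - x)) ^ 4 * v2 x ^ 2)) := by
  have ii : ∀ a b', IntervalIntegrable (fun x => max 0 ((x - l1) * (l2 - x)) ^ 4
      * (Real.exp (-(σ * b x)) ^ 2 * (v2 x ^ 2 + (σ * v1 x) ^ 2 + (σ ^ 2 * v0 x) ^ 2)))
      MeasureTheory.volume a b' := fun a b' => Continuous.intervalIntegrable (by fun_prop) _ _
  have zero : ∀ a b', a ≤ b' → (∀ x ∈ Icc a b', (x - l1) * (l2 - x) ≤ 0) →
      ∫ x in a..b', max 0 ((x - l1) * (l2 - x)) ^ 4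
      * (Real.exp (-(σ * b x)) ^ 2 * (v2 x ^ 2 + (σ * v1 x) ^ 2 + (σ ^ 2 * v0 x) ^ 2)) = 0 := by
    intro a b' hab h
    rw [intervalIntegral.integral_congr (g := fun _ => 0), intervalIntegral.integral_zero]
    intro x hx
    rw [uIcc_of_le hab] at hx
    simp only [max_eq_left (h x hx)]
    ring
  rw [← intervalIntegral.integral_add_adjacent_intervals (ii 0 l1) (ii l1 L),
    ← intervalIntegral.integral_add_adjacent_intervals (ii l1 l2) (ii l2 L),
    zero 0 l1 hl1 fun x hx => mul_nonpos_of_nonpos_of_nonneg (by linarith [hx.2])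
      (by linarith [hx.2]),
    zero l2 L hl2 fun x hx => mul_nonpos_of_nonneg_of_nonpos (by linarith [hx.1])
      (by linarith [hx.1]), zero_add, add_zero,
    ← intervalIntegral.integral_add (Continuous.intervalIntegrable (by fun_prop) _ _)
      (Continuous.intervalIntegrable (by fun_prop) _ _),
    ← intervalIntegral.integral_add (Continuous.intervalIntegrable (by fun_prop) _ _)
      (Continuous.intervalIntegrable (by fun_prop) _ _), ← intervalIntegral.integral_const_mul]
  refine intervalIntegral.integral_mono_on hl (ii _ _)
    (Continuous.intervalIntegrable (by fun_prop) _ _) fun x hx => ?_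
  obtain ⟨r, hr⟩ : ∃ r, r = (x - l1) * (l2 - x) := ⟨_, rfl⟩
  obtain ⟨ℓ, hℓ⟩ : ∃ ℓ, ℓ = (l2 - l1) ^ 2 := ⟨_, rfl⟩
  have r0 : 0 ≤ r := hr ▸ mul_nonneg (by linarith [hx.1]) (by linarith [hx.2])
  have rℓ : r ≤ ℓ := by
    rw [hr, hℓ, sq]
    exact mul_le_mul (by linarith [hx.2]) (by linarith [hx.1]) (by linarith [hx.2])
      (by linarith)
  have ℓ0 : 0 ≤ ℓ := r0.trans rℓ
  have he : Real.exp (-(σ * b x)) ^ 2 ≤ Real.exp (-(2 * m * σ)) := by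
    rw [← Real.exp_nat_mul, Real.exp_le_exp]
    have : σ * m ≤ σ * b x := by
      gcongr
      exact hb x ⟨hl1.trans hx.1, hx.2.trans hl2⟩
    push_cast
    linarith
  rw [← hr, ← hℓ, max_eq_right r0]
  have h1 : (1 : ℝ) ≤ σ ^ 4 := one_le_pow₀ hσ
  have h2 : σ ^ 2 ≤ σ ^ 4 := pow_le_pow_right₀ hσ (by norm_num)
  have t0 : r ^ 4 * (σ ^ 2 * v0 x) ^ 2 ≤ σ ^ 4 * (ℓ ^ 4 * v0 x ^ 2) := by
    calc r ^ 4 * (σ ^ 2 * v0 x) ^ 2 = σ ^ 4 * (r ^ 4 * v0 x ^ 2) := by ring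
      _ ≤ _ := by gcongr
  have t1 : r ^ 4 * (σ * v1 x) ^ 2 ≤ σ ^ 4 * (ℓ ^ 2 * (r ^ 2 * v1 x ^ 2)) := by
    calc r ^ 4 * (σ * v1 x) ^ 2 = σ ^ 2 * (r ^ 2 * (r ^ 2 * v1 x ^ 2)) := by ring
      _ ≤ _ := by gcongr
  have t2 : r ^ 4 * v2 x ^ 2 ≤ σ ^ 4 * (r ^ 4 * v2 x ^ 2) :=
    le_mul_of_one_le_left (by positivity) h1
  have tot : r ^ 4 * (v2 x ^ 2 + (σ * v1 x) ^ 2 + (σ ^ 2 * v0 x) ^ 2)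
      ≤ (1 + ℓ ^ 2 + ℓ ^ 4) * σ ^ 4
        * (v0 x ^ 2 + (r ^ 2 * v1 x ^ 2 + r ^ 4 * v2 x ^ 2)) := by
    have p1 : 0 ≤ (1 + ℓ ^ 2) * σ ^ 4 * v0 x ^ 2 := by positivity
    have p2 : 0 ≤ (1 + ℓ ^ 4) * σ ^ 4 * (r ^ 2 * v1 x ^ 2) := by positivity
    have p3 : 0 ≤ (ℓ ^ 2 + ℓ ^ 4) * σ ^ 4 * (r ^ 4 * v2 x ^ 2) := by positivity
    linarith
  calc r ^ 4 * (Real.exp (-(σ * b x)) ^ 2 * (v2 x ^ 2 + (σ * v1 x) ^ 2 + (σ ^ 2 * v0 x) ^ 2))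
      = Real.exp (-(σ * b x)) ^ 2 * (r ^ 4 * (v2 x ^ 2 + (σ * v1 x) ^ 2 + (σ ^ 2 * v0 x) ^ 2)) := by
        ring
    _ ≤ Real.exp (-(2 * m * σ)) * ((1 + ℓ ^ 2 + ℓ ^ 4) * σ ^ 4
        * (v0 x ^ 2 + (r ^ 2 * v1 x ^ 2 + r ^ 4 * v2 x ^ 2))) := by gcongr
    _ = _ := by ring

open Set in
theorem integral_window_sq_le {L l1 l2 : ℝ} (hl1 : 0 ≤ l1) (hl : l1 ≤ l2) (hl2 : l2 < L)
    {u : ℝ → ℝ} (cu : Continuous u) :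
    ∫ x in l1..l2, ((x - l1) * (l2 - x)) ^ 6 * u x ^ 2 ≤
      ((l2 - l1) ^ 2) ^ 6 / (L - l2) ^ 2 * ∫ x in (0 : ℝ)..L, (L - x) ^ 2 * u x ^ 2 := by
  have hd : 0 < L - l2 := by linarith
  calc ∫ x in l1..l2, ((x - l1) * (l2 - x)) ^ 6 * u x ^ 2
      ≤ ∫ x in l1..l2, ((l2 - l1) ^ 2) ^ 6 / (L - l2) ^ 2 * ((L - x) ^ 2 * u x ^ 2) := by
        refine intervalIntegral.integral_mono_on hl
          (Continuous.intervalIntegrable (by fun_prop) _ _)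
          (Continuous.intervalIntegrable (by fun_prop) _ _) fun x hx => ?_
        have r0 : 0 ≤ (x - l1) * (l2 - x) := mul_nonneg (by linarith [hx.1]) (by linarith [hx.2])
        have rℓ : (x - l1) * (l2 - x) ≤ (l2 - l1) ^ 2 := by
          rw [sq]
          exact mul_le_mul (by linarith [hx.2]) (by linarith [hx.1]) (by linarith [hx.2])
            (by linarith)
        have h1 : ((l2 - l1) ^ 2) ^ 6 / (L - l2) ^ 2 * (L - l2) ^ 2 = ((l2 - l1) ^ 2) ^ 6 :=
          div_mul_cancel₀ _ (by positivity)
        calc ((x - l1) * (l2 - x)) ^ 6 * u x ^ 2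
            ≤ ((l2 - l1) ^ 2) ^ 6 / (L - l2) ^ 2 * (L - l2) ^ 2 * u x ^ 2 := by
              rw [h1]; gcongr
          _ ≤ ((l2 - l1) ^ 2) ^ 6 / (L - l2) ^ 2 * (L - x) ^ 2 * u x ^ 2 := by
              have := hx.2
              gcongr
          _ = _ := by ring
    _ = ((l2 - l1) ^ 2) ^ 6 / (L - l2) ^ 2 * ∫ x in l1..l2, (L - x) ^ 2 * u x ^ 2 :=
        intervalIntegral.integral_const_mul _ _
    _ ≤ _ := by
        gcongr
        refine intervalIntegral.integral_mono_interval hl1 hl hl2.le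
          (Filter.Eventually.of_forall fun x => ?_)
          (Continuous.intervalIntegrable (by fun_prop) _ _)
        show 0 ≤ (L - x) ^ 2 * u x ^ 2
        positivity

theorem exists_pow_mul_exp_neg_le (n : ℕ) {d : ℝ} (hd : 0 < d) :
    ∃ C, 0 < C ∧ ∀ σ, 0 ≤ σ → σ ^ n * Real.exp (-(d * σ)) ≤ C := by
  refine ⟨n.factorial / d ^ n, by positivity, fun σ hσ => ?_⟩
  have h := Real.pow_div_factorial_le_exp (d * σ) (by positivity) n
  rw [Real.exp_neg, ← div_eq_mul_inv, div_le_div_iff₀ (Real.exp_pos _) (by positivity)]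
  rw [div_le_iff₀ (by positivity), mul_pow] at h
  linarith

/-- Combination at a fixed time of the Carleman estimate, the smoothing estimate and the
interpolation inequality, in which all integrals are abstracted to real numbers. -/
theorem exists_combination_const {T L m M κ K Γ Cp Ki C3 : ℝ} (hT : 0 < T) (hL : 0 < L)
    (hm : 0 < m) (hmM : m < M) (hκ : 0 < κ) (hK : 0 ≤ K) (hΓ : 1 ≤ Γ) (hCp : 1 ≤ Cp)
    (hKi : 0 < Ki) (hC3 : 0 ≤ C3) :
    ∃ ν C, 0 < ν ∧ 0 < C ∧ ∀ σ w θ1 γ, 1 ≤ σ → 0 < w → w ≤ T ^ 2 →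
      |θ1| ≤ T * (1 + 2 * M * σ) * Real.exp (-(2 * M * σ)) → 1 ≤ γ → γ ≤ Γ →
      ∀ D' Q QP Z V Y Y' G I0 I1 I2 I3, 0 ≤ V → 0 ≤ Z → 0 ≤ I0 → 0 ≤ I1 + I2 → 0 ≤ Y →
        D' + κ * σ * Q ≤ K * σ * QP → 8 * Z ≤ Y' + (6 + 9 * L) * V + G * Y →
        Real.exp (-(2 * M * σ)) * V ≤ Q → Y ≤ L ^ 3 * V →
        QP ≤ Cp * σ ^ 4 * Real.exp (-(2 * m * σ)) * (I0 + (I1 + I2)) →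
        (∀ a, 0 < a → a ≤ 1 → I1 + I2 ≤ a * I3 + Ki / a ^ 2 * I0) → I3 ≤ C3 * Z →
        D' - ν * (θ1 * γ * Y + w * Real.exp (-(2 * M * σ)) * (γ * G) * Y
            + w * Real.exp (-(2 * M * σ)) * γ * Y') + κ / 2 * (σ * Q) ≤
          C * (w⁻¹) ^ 2 * Real.exp ((6 * M - 8 * m) * σ) * I0 := by
  have hM : 0 < M := hm.trans hmM
  have hΓ0 : 0 < Γ := by linarith
  have hCp0 : 0 < Cp := by linarith
  obtain ⟨Ce, hCe, hexp⟩ := exists_pow_mul_exp_neg_le 15 (d := 2 * (M - m)) (by linarith)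
  obtain ⟨B, hB⟩ : ∃ B, B = Γ * (T * (1 + 2 * M) * L ^ 3 + T ^ 2 * (6 + 9 * L)) := ⟨_, rfl⟩
  have hB0 : 0 < B := by rw [hB]; positivity
  obtain ⟨ν, hν⟩ : ∃ ν, ν = κ / (2 * B) := ⟨_, rfl⟩
  have hν0 : 0 < ν := by rw [hν]; positivity
  have hνB : ν * B = κ / 2 := by rw [hν]; field_simp
  obtain ⟨N, hN⟩ : ∃ N, N = C3 + 8 * ν * T ^ 2 := ⟨_, rfl⟩
  have hN0 : 0 < N := by rw [hN]; positivity
  refine ⟨ν, (1 + Ki) * ((K + 1) * Cp) ^ 3 * N ^ 2 / (64 * ν ^ 2) * Ce, hν0, by positivity, ?_⟩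
  intro σ w θ1 γ hσ hw hwT hθ1 hγ1 hγ D' Q QP Z V Y Y' G I0 I1 I2 I3 hV hZ hI0 hI12 hY hD hZY hVQ
    hYV hQP hint hI3
  have hσ0 : 0 < σ := by linarith
  have hγ0 : 0 < γ := by linarith
  obtain ⟨eM, heM⟩ : ∃ eM, eM = Real.exp (-(2 * M * σ)) := ⟨_, rfl⟩
  obtain ⟨em, hem⟩ : ∃ em, em = Real.exp (-(2 * m * σ)) := ⟨_, rfl⟩
  rw [← heM] at hθ1 hVQ ⊢
  rw [← hem] at hQP
  have eM0 : 0 < eM := heM ▸ Real.exp_pos _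
  have em0 : 0 < em := hem ▸ Real.exp_pos _
  have eMm : eM ≤ em := by
    rw [heM, hem, Real.exp_le_exp, neg_le_neg_iff]
    gcongr
  have sm : -(w * eM * γ * Y') - w * eM * (γ * G) * Y
      ≤ -(8 * (w * eM) * Z) + Γ * (w * eM * ((6 + 9 * L) * V)) := by
    have h1 := mul_le_mul_of_nonneg_left hZY (by positivity : 0 ≤ w * eM * γ)
    have h2 : 8 * (w * eM) * Z * 1 ≤ 8 * (w * eM) * Z * γ := by gcongr
    have h3 : γ * (w * eM * ((6 + 9 * L) * V)) ≤ Γ * (w * eM * ((6 + 9 * L) * V)) := by gcongr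
    linarith
  have tm : -(θ1 * γ * Y) ≤ Γ * (T * (1 + 2 * M * σ) * eM * (L ^ 3 * V)) := by
    calc -(θ1 * γ * Y) ≤ |θ1| * γ * Y := by
          have := neg_abs_le θ1
          have := mul_le_mul_of_nonneg_right this (by positivity : 0 ≤ γ * Y)
          linarith
      _ ≤ (T * (1 + 2 * M * σ) * eM) * Γ * (L ^ 3 * V) := by gcongr
      _ = _ := by ring
  have bd : Γ * (w * eM * ((6 + 9 * L) * V)) + Γ * (T * (1 + 2 * M * σ) * eM * (L ^ 3 * V))
      ≤ B * (σ * Q) := by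
    have h1 : Γ * (w * eM * ((6 + 9 * L) * V)) ≤ Γ * (σ * T ^ 2 * eM * ((6 + 9 * L) * V)) := by
      have : 1 * w ≤ σ * T ^ 2 := mul_le_mul hσ hwT hw.le hσ0.le
      rw [one_mul] at this
      gcongr
    have h2 : Γ * (T * (1 + 2 * M * σ) * eM * (L ^ 3 * V))
        ≤ Γ * (T * (1 * σ + 2 * M * σ) * eM * (L ^ 3 * V)) := by
      gcongr
      linarith
    have h3 : B * σ * (eM * V) ≤ B * σ * Q := by gcongr
    have h4 : B * σ * (eM * V) = Γ * (σ * T ^ 2 * eM * ((6 + 9 * L) * V))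
        + Γ * (T * (1 * σ + 2 * M * σ) * eM * (L ^ 3 * V)) := by rw [hB]; ring
    linarith
  have bd' := mul_le_mul_of_nonneg_left bd hν0.le
  rw [← mul_assoc ν B, hνB] at bd'
  have sm' := mul_le_mul_of_nonneg_left sm hν0.le
  have tm' := mul_le_mul_of_nonneg_left tm hν0.le
  obtain ⟨A, hA⟩ : ∃ A, A = (K + 1) * Cp * σ ^ 5 * em := ⟨_, rfl⟩
  have hA0 : 0 < A := by rw [hA]; positivity
  have obs : K * σ * QP ≤ A * (I0 + (I1 + I2)) := by
    calc K * σ * QP ≤ K * σ * (Cp * σ ^ 4 * em * (I0 + (I1 + I2))) := by gcongr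
      _ ≤ (K + 1) * σ * (Cp * σ ^ 4 * em * (I0 + (I1 + I2))) := by gcongr; linarith
      _ = _ := by rw [hA]; ring
  obtain ⟨a, ha⟩ : ∃ a, a = 8 * ν * (w * eM) / (A * N) := ⟨_, rfl⟩
  have ha0 : 0 < a := by rw [ha]; positivity
  have ha1 : a ≤ 1 := by
    rw [ha, div_le_one (by positivity)]
    have h1 : 1 * em ≤ A := by
      rw [hA]
      gcongr
      calc (1 : ℝ) = 1 * 1 * 1 := by norm_num
        _ ≤ (K + 1) * Cp * σ ^ 5 := by
          gcongr
          · linarith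
          · exact one_le_pow₀ hσ
    calc 8 * ν * (w * eM) ≤ 8 * ν * (T ^ 2 * em) := by gcongr
      _ = (1 * em) * (8 * ν * T ^ 2) := by ring
      _ ≤ A * N := by
        gcongr
        rw [hN]; linarith
  have hAaN : A * a * N = 8 * ν * (w * eM) := by rw [ha]; field_simp
  have fin1 : A * (I0 + (I1 + I2)) ≤ 8 * ν * (w * eM) * Z + A * (1 + Ki) / a ^ 2 * I0 := by
    have h1 := mul_le_mul_of_nonneg_left (hint a ha0 ha1) hA0.le
    have h2 : A * a * I3 ≤ A * a * (N * Z) := by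
      have : C3 * Z ≤ N * Z := by
        gcongr
        rw [hN]
        linarith [(by positivity : 0 ≤ 8 * ν * T ^ 2)]
      have := hI3.trans this
      gcongr
    have h3 : A * I0 ≤ A / a ^ 2 * I0 := by
      gcongr
      exact le_div_self hA0.le (by positivity) (pow_le_one₀ ha0.le ha1)
    have h4 : A * a * (N * Z) = 8 * ν * (w * eM) * Z := by rw [← hAaN]; ring
    have h5 : A * (1 + Ki) / a ^ 2 * I0 = A / a ^ 2 * I0 + A * (Ki / a ^ 2 * I0) := by ring
    rw [h5]
    linarith
  have fin2 : A * (1 + Ki) / a ^ 2 ≤ (1 + Ki) * ((K + 1) * Cp) ^ 3 * N ^ 2 / (64 * ν ^ 2) * Ce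
      * (w⁻¹) ^ 2 * Real.exp ((6 * M - 8 * m) * σ) := by
    have h1 : A * (1 + Ki) / a ^ 2 = (1 + Ki) * ((K + 1) * Cp) ^ 3 * N ^ 2 / (64 * ν ^ 2)
        * (w⁻¹) ^ 2 * (σ ^ 15 * (em ^ 3 / eM ^ 2)) := by
      rw [ha, hA]
      field_simp
      ring
    have h2 : em ^ 3 / eM ^ 2 = Real.exp (-(2 * (M - m) * σ)) * Real.exp ((6 * M - 8 * m) * σ) := by
      rw [hem, heM, ← Real.exp_nat_mul, ← Real.exp_nat_mul, ← Real.exp_sub, ← Real.exp_add]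
      congr 1
      push_cast
      ring
    have h3 := hexp σ hσ0.le
    rw [h1, h2]
    calc _ = (1 + Ki) * ((K + 1) * Cp) ^ 3 * N ^ 2 / (64 * ν ^ 2) * (w⁻¹) ^ 2
          * Real.exp ((6 * M - 8 * m) * σ) * (σ ^ 15 * Real.exp (-(2 * (M - m) * σ))) := by ring
      _ ≤ (1 + Ki) * ((K + 1) * Cp) ^ 3 * N ^ 2 / (64 * ν ^ 2) * (w⁻¹) ^ 2
          * Real.exp ((6 * M - 8 * m) * σ) * Ce := by gcongr
      _ = _ := by ring
  have fin3 := mul_le_mul_of_nonneg_right fin2 hI0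
  linarith

open Set in
/-- If a differentiable function vanishes on an open interval, then it and its derivative vanish
on the closed interval. -/
theorem eq_zero_on_Icc_of_Ioo {L : ℝ} (hL : 0 < L) {f f' : ℝ → ℝ} (hf : ∀ x, HasDerivAt f (f' x) x)
    (cf' : Continuous f') (h : ∀ x ∈ Ioo 0 L, f x = 0) :
    ∀ x ∈ Icc 0 L, f x = 0 ∧ f' x = 0 := by
  have cf : Continuous f := continuous_iff_continuousAt.2 fun x => (hf x).continuousAt
  have h' : ∀ x ∈ Ioo 0 L, f' x = 0 := fun x hx => by
    refine (hf x).unique (((hasDerivAt_const x (0 : ℝ))).congr_of_eventuallyEq ?_)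
    filter_upwards [Ioo_mem_nhds hx.1 hx.2] with y hy using h y hy
  intro x hx
  rw [← closure_Ioo hL.ne] at hx
  exact ⟨EqOn.closure (g := fun _ => 0) h cf continuous_const hx,
    EqOn.closure (g := fun _ => 0) h' cf' continuous_const hx⟩

/-- Smooth solutions of the adjoint linearized KdV equation on `(0,T) × (0,L)`. -/
structure IsAdjointSolution (T L : ℝ) (ξ v : ℝ → ℝ → ℝ) : Prop where
  smooth_coeff : ContDiff ℝ (⊤ : ℕ∞) (Function.uncurry ξ)
  smooth : ContDiff ℝ (⊤ : ℕ∞) (Function.uncurry v)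
  pde : ∀ t ∈ Set.Ioo (0 : ℝ) T, ∀ x ∈ Set.Ioo (0 : ℝ) L,
    -pdt v t x - ξ t x * pdx v t x - pdx (pdx (pdx v)) t x = 0
  bc : ∀ t ∈ Set.Icc (0 : ℝ) T, v t 0 = 0 ∧ v t L = 0 ∧ pdx v t 0 = 0

/-- The space derivative of `ξ v_x`. -/
noncomputable def advectionDeriv (ξ v : ℝ → ℝ → ℝ) : ℝ → ℝ → ℝ := fun t x =>
  pdx ξ t x * pdx v t x + ξ t x * pdx (pdx v) t x

namespace IsAdjointSolution

open Set

variable {T L : ℝ} {ξ v : ℝ → ℝ → ℝ}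

theorem smooth_pdx (h : IsAdjointSolution T L ξ v) :
    ContDiff ℝ (⊤ : ℕ∞) (Function.uncurry (pdx v)) := contDiff_pdx h.smooth

theorem smooth_pdx2 (h : IsAdjointSolution T L ξ v) :
    ContDiff ℝ (⊤ : ℕ∞) (Function.uncurry (pdx (pdx v))) := contDiff_pdx h.smooth_pdx

theorem smooth_pdx3 (h : IsAdjointSolution T L ξ v) :
    ContDiff ℝ (⊤ : ℕ∞) (Function.uncurry (pdx (pdx (pdx v)))) := contDiff_pdx h.smooth_pdx2

theorem smooth_pdx4 (h : IsAdjointSolution T L ξ v) :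
    ContDiff ℝ (⊤ : ℕ∞) (Function.uncurry (pdx (pdx (pdx (pdx v))))) := contDiff_pdx h.smooth_pdx3

theorem smooth_pdt (h : IsAdjointSolution T L ξ v) :
    ContDiff ℝ (⊤ : ℕ∞) (Function.uncurry (pdt v)) := contDiff_pdt h.smooth

theorem smooth_advectionDeriv (h : IsAdjointSolution T L ξ v) :
    ContDiff ℝ (⊤ : ℕ∞) (Function.uncurry (advectionDeriv ξ v)) :=
  ((contDiff_pdx h.smooth_coeff).mul h.smooth_pdx).add (h.smooth_coeff.mul h.smooth_pdx2)

theorem hasDerivAt_residual (h : IsAdjointSolution T L ξ v) (t x : ℝ) :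
    HasDerivAt (fun x => pdt v t x + ξ t x * pdx v t x + pdx (pdx (pdx v)) t x)
      (pdt (pdx v) t x + advectionDeriv ξ v t x + pdx (pdx (pdx (pdx v))) t x) x := by
  rw [pdt_pdx_comm h.smooth]
  exact ((hasDerivAt_pdx h.smooth_pdt t x).fun_add ((hasDerivAt_pdx h.smooth_coeff t x).fun_mul
    (hasDerivAt_pdx h.smooth_pdx t x))).fun_add (hasDerivAt_pdx h.smooth_pdx3 t x)

theorem hasDerivAt_residual_deriv (h : IsAdjointSolution T L ξ v) (t x : ℝ) :
    HasDerivAt (fun x => pdt (pdx v) t x + advectionDeriv ξ v t x + pdx (pdx (pdx (pdx v))) t x)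
      (pdt (pdx (pdx v)) t x + pdx (advectionDeriv ξ v) t x
        + pdx (pdx (pdx (pdx (pdx v)))) t x) x := by
  rw [pdt_pdx_comm h.smooth_pdx]
  exact ((hasDerivAt_pdx (contDiff_pdt h.smooth_pdx) t x).fun_add
    (hasDerivAt_pdx h.smooth_advectionDeriv t x)).fun_add (hasDerivAt_pdx h.smooth_pdx4 t x)

theorem residual_deriv_eq_zero (h : IsAdjointSolution T L ξ v) (hL : 0 < L) {t : ℝ}
    (ht : t ∈ Ioo 0 T) : ∀ x ∈ Icc 0 L,
      pdt v t x + ξ t x * pdx v t x + pdx (pdx (pdx v)) t x = 0 ∧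
      pdt (pdx v) t x + advectionDeriv ξ v t x + pdx (pdx (pdx (pdx v))) t x = 0 :=
  eq_zero_on_Icc_of_Ioo hL (h.hasDerivAt_residual t)
    (continuous_iff_continuousAt.2 fun x => (h.hasDerivAt_residual_deriv t x).continuousAt)
    fun x hx => by linarith [h.pde t ht x hx]

theorem pdt_eq (h : IsAdjointSolution T L ξ v) (hL : 0 < L) {t : ℝ} (ht : t ∈ Ioo 0 T) :
    ∀ x ∈ Icc 0 L, pdt v t x = -(ξ t x * pdx v t x) - pdx (pdx (pdx v)) t x := fun x hx => by
  linarith [(h.residual_deriv_eq_zero hL ht x hx).1]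

theorem pdt_pdx2_eq (h : IsAdjointSolution T L ξ v) (hL : 0 < L) {t : ℝ} (ht : t ∈ Ioo 0 T) :
    ∀ x ∈ Icc 0 L, pdt (pdx (pdx v)) t x
      = -pdx (advectionDeriv ξ v) t x - pdx (pdx (pdx (pdx (pdx v)))) t x := fun x hx => by
  have c := ((continuous_slice (contDiff_pdt h.smooth_pdx2) t).add
    (continuous_slice (contDiff_pdx h.smooth_advectionDeriv) t)).add
    (continuous_slice (contDiff_pdx h.smooth_pdx4) t)
  linarith [(eq_zero_on_Icc_of_Ioo hL (h.hasDerivAt_residual_deriv t) c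
    (fun x hx => (h.residual_deriv_eq_zero hL ht x (Ioo_subset_Icc_self hx)).2) x hx).2]

theorem pdt_eq_zero_of_boundary {u : ℝ → ℝ → ℝ} {y t : ℝ} (ht : t ∈ Ioo 0 T)
    (hu : ∀ s ∈ Icc 0 T, u s y = 0) : pdt u t y = 0 := by
  have : (fun s => u s y) =ᶠ[nhds t] fun _ => 0 := by
    filter_upwards [Ioo_mem_nhds ht.1 ht.2] with s hs using hu s (Ioo_subset_Icc_self hs)
  exact this.deriv_eq.trans (deriv_const t 0)

theorem pdt_right_eq_zero (h : IsAdjointSolution T L ξ v) {t : ℝ} (ht : t ∈ Ioo 0 T) :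
    pdt v t L = 0 := pdt_eq_zero_of_boundary ht fun s hs => (h.bc s hs).2.1

theorem pdx3_left_eq_zero (h : IsAdjointSolution T L ξ v) (hL : 0 < L) {t : ℝ}
    (ht : t ∈ Ioo 0 T) : pdx (pdx (pdx v)) t 0 = 0 := by
  have h1 := h.pdt_eq hL ht 0 (left_mem_Icc.2 hL.le)
  rw [pdt_eq_zero_of_boundary ht fun s hs => (h.bc s hs).1,
    (h.bc t (Ioo_subset_Icc_self ht)).2.2] at h1
  linarith

theorem pdx4_left_add_eq_zero (h : IsAdjointSolution T L ξ v) (hL : 0 < L) {t : ℝ}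
    (ht : t ∈ Ioo 0 T) : pdx (pdx (pdx (pdx v))) t 0 + advectionDeriv ξ v t 0 = 0 := by
  have h1 := (h.residual_deriv_eq_zero hL ht 0 (left_mem_Icc.2 hL.le)).2
  rw [pdt_eq_zero_of_boundary ht fun s hs => (h.bc s hs).2.2] at h1
  linarith

end IsAdjointSolution

/-- The boundary-in-time functional of the Carleman estimate. -/
noncomputable def CarlemanWeight.flux {L : ℝ} (W : CarlemanWeight L) (v : ℝ → ℝ → ℝ) (σ t : ℝ) :
    ℝ :=
  ∫ x in (0 : ℝ)..L,
    (-3 * σ * W.b1 x * (Real.exp (-(σ * W.b0 x)) * (pdx v t x - σ * W.b1 x * v t x)) ^ 2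
      + σ ^ 3 * W.b1 x ^ 3 * (Real.exp (-(σ * W.b0 x)) * v t x) ^ 2)

/-- The time derivative of `CarlemanWeight.flux` along a parameter with velocity `σ₁`. -/
noncomputable def CarlemanWeight.fluxDeriv {L : ℝ} (W : CarlemanWeight L) (v : ℝ → ℝ → ℝ)
    (σ σ₁ t : ℝ) : ℝ :=
  ∫ x in (0 : ℝ)..L,
    (-3 * σ₁ * W.b1 x * (Real.exp (-(σ * W.b0 x)) * (pdx v t x - σ * W.b1 x * v t x)) ^ 2
    - 6 * σ * W.b1 x * (Real.exp (-(σ * W.b0 x)) * (pdx v t x - σ * W.b1 x * v t x))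
      * (Real.exp (-(σ * W.b0 x)) * (pdx (pdt v) t x
        - σ₁ * (W.b1 x * v t x + W.b0 x * pdx v t x)
        - σ * W.b1 x * (pdt v t x - σ₁ * (W.b0 x * v t x))))
    + 3 * σ ^ 2 * σ₁ * W.b1 x ^ 3 * (Real.exp (-(σ * W.b0 x)) * v t x) ^ 2
    + 2 * σ ^ 3 * W.b1 x ^ 3 * (Real.exp (-(σ * W.b0 x)) * v t x)
      * (Real.exp (-(σ * W.b0 x)) * (pdt v t x - σ₁ * (W.b0 x * v t x))))

open Set in
theorem CarlemanWeight.hasDerivAt_flux {L T : ℝ} (hL : 0 < L) (W : CarlemanWeight L)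
    {v : ℝ → ℝ → ℝ} (hv : ContDiff ℝ (⊤ : ℕ∞) (Function.uncurry v)) {σ σ₁ : ℝ → ℝ}
    (hσ : ∀ t ∈ Ioo 0 T, HasDerivAt σ (σ₁ t) t) (cσ₁ : ContinuousOn σ₁ (Ioo 0 T)) {t : ℝ}
    (ht : t ∈ Ioo 0 T) :
    HasDerivAt (fun t => W.flux v (σ t) t)
      (W.fluxDeriv v (σ t) (σ₁ t) t) t := by
  have cb0 := W.cont0
  have cb1 := W.cont1
  have cv := hv.continuous
  have cv1 := (contDiff_pdx hv).continuous
  have cvt := (contDiff_pdt hv).continuous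
  have cvt1 := (contDiff_pdx (contDiff_pdt hv)).continuous
  have cσ : ContinuousOn σ (Ioo 0 T) := fun s hs => (hσ s hs).continuousAt.continuousWithinAt
  refine hasDerivAt_intervalIntegral_of_continuousOn
    (F := fun t x =>
      -3 * σ t * W.b1 x * (Real.exp (-(σ t * W.b0 x)) * (pdx v t x - σ t * W.b1 x * v t x)) ^ 2
      + σ t ^ 3 * W.b1 x ^ 3 * (Real.exp (-(σ t * W.b0 x)) * v t x) ^ 2)
    (F' := fun t x => -3 * σ₁ t * W.b1 x
          * (Real.exp (-(σ t * W.b0 x)) * (pdx v t x - σ t * W.b1 x * v t x)) ^ 2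
        - 6 * σ t * W.b1 x * (Real.exp (-(σ t * W.b0 x)) * (pdx v t x - σ t * W.b1 x * v t x))
          * (Real.exp (-(σ t * W.b0 x)) * (pdx (pdt v) t x
            - σ₁ t * (W.b1 x * v t x + W.b0 x * pdx v t x)
            - σ t * W.b1 x * (pdt v t x - σ₁ t * (W.b0 x * v t x))))
        + 3 * σ t ^ 2 * σ₁ t * W.b1 x ^ 3 * (Real.exp (-(σ t * W.b0 x)) * v t x) ^ 2
        + 2 * σ t ^ 3 * W.b1 x ^ 3 * (Real.exp (-(σ t * W.b0 x)) * v t x)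
          * (Real.exp (-(σ t * W.b0 x)) * (pdt v t x - σ₁ t * (W.b0 x * v t x))))
    hL.le ?_ ?_ ?_ ht
  · intro s _
    have := continuous_slice hv s
    have := continuous_slice (contDiff_pdx hv) s
    exact Continuous.continuousOn (by fun_prop)
  · intro s hs x _
    have hs' := hσ s hs
    have e := (hs'.mul_const (W.b0 x)).fun_neg.exp
    have dv := hasDerivAt_pdt hv s x
    have dv1 := hasDerivAt_pdt (contDiff_pdx hv) s x
    rw [pdt_pdx_comm hv] at dv1
    have := ((((hs'.const_mul (-3)).mul_const (W.b1 x)).fun_mul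
      ((e.fun_mul (dv1.fun_sub ((hs'.mul_const (W.b1 x)).fun_mul dv))).fun_pow 2))).fun_add
      (((hs'.fun_pow 3).mul_const (W.b1 x ^ 3)).fun_mul ((e.fun_mul dv).fun_pow 2))
    refine this.congr_deriv ?_
    push_cast
    ring
  · have hΓ : Continuous fun q : (ℝ × ℝ) × ℝ × ℝ => -3 * q.1.2 * W.b1 q.2.2
          * (Real.exp (-(q.1.1 * W.b0 q.2.2)) * (Function.uncurry (pdx v) q.2
            - q.1.1 * W.b1 q.2.2 * Function.uncurry v q.2)) ^ 2
        - 6 * q.1.1 * W.b1 q.2.2 * (Real.exp (-(q.1.1 * W.b0 q.2.2))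
            * (Function.uncurry (pdx v) q.2 - q.1.1 * W.b1 q.2.2 * Function.uncurry v q.2))
          * (Real.exp (-(q.1.1 * W.b0 q.2.2)) * (Function.uncurry (pdx (pdt v)) q.2
            - q.1.2 * (W.b1 q.2.2 * Function.uncurry v q.2
              + W.b0 q.2.2 * Function.uncurry (pdx v) q.2)
            - q.1.1 * W.b1 q.2.2 * (Function.uncurry (pdt v) q.2
              - q.1.2 * (W.b0 q.2.2 * Function.uncurry v q.2))))
        + 3 * q.1.1 ^ 2 * q.1.2 * W.b1 q.2.2 ^ 3
          * (Real.exp (-(q.1.1 * W.b0 q.2.2)) * Function.uncurry v q.2) ^ 2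
        + 2 * q.1.1 ^ 3 * W.b1 q.2.2 ^ 3 * (Real.exp (-(q.1.1 * W.b0 q.2.2))
            * Function.uncurry v q.2)
          * (Real.exp (-(q.1.1 * W.b0 q.2.2)) * (Function.uncurry (pdt v) q.2
            - q.1.2 * (W.b0 q.2.2 * Function.uncurry v q.2))) := by fun_prop
    have hm : MapsTo (Prod.fst : ℝ × ℝ → ℝ) (Ioo 0 T ×ˢ Icc 0 L) (Ioo 0 T) := fun p hp => hp.1
    exact hΓ.comp_continuousOn (((cσ.comp continuousOn_fst hm).prodMk
      (cσ₁.comp continuousOn_fst hm)).prodMk continuousOn_id)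

open Set in
/-- The time functional is negligible for large values of the parameter. -/
theorem CarlemanWeight.exists_abs_flux_le {L T m : ℝ} (hL : 0 < L) (W : CarlemanWeight L)
    (hm : ∀ x ∈ Icc 0 L, m ≤ W.b0 x) {v : ℝ → ℝ → ℝ}
    (hv : ContDiff ℝ (⊤ : ℕ∞) (Function.uncurry v)) :
    ∃ K, 0 ≤ K ∧ ∀ t ∈ Icc 0 T, ∀ σ, 1 ≤ σ →
      |W.flux v σ t| ≤ K * (σ ^ 3 * Real.exp (-(2 * m * σ))) := by
  obtain ⟨N0, hN0⟩ := (isCompact_Icc.prod isCompact_Icc : IsCompact (Icc 0 T ×ˢ Icc 0 L)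
    ).exists_bound_of_continuousOn hv.continuous.continuousOn
  obtain ⟨N1, hN1⟩ := (isCompact_Icc.prod isCompact_Icc : IsCompact (Icc 0 T ×ˢ Icc 0 L)
    ).exists_bound_of_continuousOn (contDiff_pdx hv).continuous.continuousOn
  have hB := W.one_le_B
  have hB0 : 0 ≤ W.B := by linarith
  refine ⟨(3 * W.B * (|N1| + W.B * |N0|) ^ 2 + W.B ^ 3 * |N0| ^ 2) * L, by positivity, ?_⟩
  intro t ht σ hσ
  have hσ0 : 0 ≤ σ := by linarith
  have hb : ∀ x ∈ uIoc 0 L, ‖-3 * σ * W.b1 x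
        * (Real.exp (-(σ * W.b0 x)) * (pdx v t x - σ * W.b1 x * v t x)) ^ 2
      + σ ^ 3 * W.b1 x ^ 3 * (Real.exp (-(σ * W.b0 x)) * v t x) ^ 2‖
      ≤ (3 * W.B * (|N1| + W.B * |N0|) ^ 2 + W.B ^ 3 * |N0| ^ 2)
        * (σ ^ 3 * Real.exp (-(2 * m * σ))) := by
    intro x hx
    rw [uIoc_of_le hL.le] at hx
    have hx' : x ∈ Icc 0 L := Ioc_subset_Icc_self hx
    have a0 : |v t x| ≤ |N0| := (hN0 (t, x) ⟨ht, hx'⟩).trans (le_abs_self _)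
    have a1 : |pdx v t x| ≤ |N1| := (hN1 (t, x) ⟨ht, hx'⟩).trans (le_abs_self _)
    have b1 := W.abs_b1 x hx'
    have he : Real.exp (-(σ * W.b0 x)) ^ 2 ≤ Real.exp (-(2 * m * σ)) := by
      rw [← Real.exp_nat_mul, Real.exp_le_exp]
      have : σ * m ≤ σ * W.b0 x := by
        gcongr
        exact hm x hx'
      push_cast
      linarith
    have q : |pdx v t x - σ * W.b1 x * v t x| ≤ σ * (|N1| + W.B * |N0|) := by
      calc |pdx v t x - σ * W.b1 x * v t x| ≤ |pdx v t x| + |σ * W.b1 x * v t x| := abs_sub _ _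
        _ = |pdx v t x| + σ * (|W.b1 x| * |v t x|) := by
          rw [abs_mul, abs_mul, abs_of_nonneg hσ0, mul_assoc]
        _ ≤ 1 * |N1| + σ * (W.B * |N0|) := by rw [one_mul]; gcongr
        _ ≤ σ * |N1| + σ * (W.B * |N0|) := by gcongr
        _ = _ := by ring
    rw [Real.norm_eq_abs]
    refine (abs_add_le _ _).trans ?_
    have t1 : |-3 * σ * W.b1 x * (Real.exp (-(σ * W.b0 x)) * (pdx v t x - σ * W.b1 x * v t x)) ^ 2|
        ≤ 3 * W.B * (|N1| + W.B * |N0|) ^ 2 * (σ ^ 3 * Real.exp (-(2 * m * σ))) := by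
      calc _ = 3 * σ * |W.b1 x| * (Real.exp (-(σ * W.b0 x)) ^ 2
            * |pdx v t x - σ * W.b1 x * v t x| ^ 2) := by
            rw [abs_mul, abs_mul, abs_mul, abs_of_nonneg hσ0, abs_sq, sq_abs,
              abs_neg, Nat.abs_ofNat]
            ring
        _ ≤ 3 * σ * W.B * (Real.exp (-(2 * m * σ)) * (σ * (|N1| + W.B * |N0|)) ^ 2) := by gcongr
        _ = _ := by ring
    have t2 : |σ ^ 3 * W.b1 x ^ 3 * (Real.exp (-(σ * W.b0 x)) * v t x) ^ 2|
        ≤ W.B ^ 3 * |N0| ^ 2 * (σ ^ 3 * Real.exp (-(2 * m * σ))) := by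
      calc _ = σ ^ 3 * |W.b1 x| ^ 3 * (Real.exp (-(σ * W.b0 x)) ^ 2 * |v t x| ^ 2) := by
            rw [abs_mul, abs_mul, abs_pow, abs_pow, abs_of_nonneg hσ0,
              abs_sq, sq_abs]
            ring
        _ ≤ σ ^ 3 * W.B ^ 3 * (Real.exp (-(2 * m * σ)) * |N0| ^ 2) := by gcongr
        _ = _ := by ring
    linarith
  have := intervalIntegral.norm_integral_le_of_norm_le_const hb
  rw [Real.norm_eq_abs, sub_zero, abs_of_pos hL] at this
  exact this.trans (le_of_eq (by ring))

open Set in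
theorem hasDerivAt_integral_cube_mul_sq {L : ℝ} (hL : 0 < L) {u : ℝ → ℝ → ℝ}
    (hu : ContDiff ℝ (⊤ : ℕ∞) (Function.uncurry u)) (t : ℝ) :
    HasDerivAt (fun t => ∫ x in (0 : ℝ)..L, (L - x) ^ 3 * u t x ^ 2)
      (∫ x in (0 : ℝ)..L, (L - x) ^ 3 * (2 * u t x * pdt u t x)) t := by
  have cu := hu.continuous
  have cut := (contDiff_pdt hu).continuous
  refine hasDerivAt_intervalIntegral_of_continuousOn (a := t - 1) (b := t + 1)
    (F := fun t x => (L - x) ^ 3 * u t x ^ 2)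
    (F' := fun t x => (L - x) ^ 3 * (2 * u t x * pdt u t x)) hL.le ?_ ?_ ?_ (by simp)
  · intro s _
    have := continuous_slice hu s
    exact Continuous.continuousOn (by fun_prop)
  · intro s _ x _
    exact (((hasDerivAt_pdt hu s x).fun_pow 2).const_mul _).congr_deriv (by push_cast; ring)
  · have : Continuous fun q : ℝ × ℝ => (L - q.2) ^ 3
        * (2 * Function.uncurry u q * Function.uncurry (pdt u) q) := by fun_prop
    exact this.continuousOn

open Set MeasureTheory in
theorem integrableOn_pow_mul_exp_mul {T d : ℝ} (n : ℕ) (hd : 0 < d) {σ : ℝ → ℝ}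
    (mσ : Measurable σ) (h0 : ∀ t ∈ Icc 0 T, 0 ≤ σ t) {A : ℝ → ℝ} (cA : Continuous A) :
    IntegrableOn (fun t => σ t ^ n * Real.exp (-(d * σ t)) * A t) (Icc 0 T) := by
  obtain ⟨C, hC, hexp⟩ := exists_pow_mul_exp_neg_le n hd
  obtain ⟨N, hN⟩ := (isCompact_Icc (a := 0) (b := T)).exists_bound_of_continuousOn cA.continuousOn
  refine Measure.integrableOn_of_bounded (M := C * N) (by simp) ?_ ?_
  · have : Measurable fun t => σ t ^ n * Real.exp (-(d * σ t)) * A t :=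
      ((mσ.pow_const n).mul (Real.measurable_exp.comp (mσ.const_mul d).neg)).mul cA.measurable
    exact this.aestronglyMeasurable
  · filter_upwards [ae_restrict_mem measurableSet_Icc] with t ht
    have h1 := hexp (σ t) (h0 t ht)
    have h2 : 0 ≤ σ t ^ n := pow_nonneg (h0 t ht) n
    rw [norm_mul, Real.norm_of_nonneg (by positivity)]
    exact mul_le_mul h1 (hN t ht) (norm_nonneg _) hC.le

open Set in
theorem continuous_integral_slice {c d : ℝ} {F : ℝ → ℝ → ℝ}
    (hF : Continuous (Function.uncurry F)) : Continuous fun t => ∫ x in c..d, F t x :=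
  intervalIntegral.continuous_parametric_intervalIntegral_of_continuous' hF c d

open Set in
/-- The differential inequality behind the Carleman estimate, at a fixed time `t`. -/
theorem exists_slice_inequality {T L l1 l2 m M : ℝ} (hT : 0 < T) (hl1 : 0 < l1) (hl : l1 < l2)
    (hl2 : l2 < L) (hm : 0 < m) (hmM : m < M) (W : CarlemanWeight L)
    (hWP : W.P = fun x => max 0 ((x - l1) * (l2 - x)) ^ 4)
    (hW : ∀ x ∈ Icc 0 L, m ≤ W.b0 x ∧ W.b0 x ≤ M) (R : ℝ) {Γ : ℝ} (hΓ : 1 ≤ Γ) :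
    ∃ s₀ ν μ C, 1 ≤ s₀ ∧ T ^ 2 ≤ s₀ ∧ 0 < ν ∧ 0 < μ ∧ 0 < C ∧ ∀ ξ v : ℝ → ℝ → ℝ,
      IsAdjointSolution T L ξ v → ∀ t ∈ Ioo 0 T, (∫ x in (0 : ℝ)..L, ξ t x ^ 2) ≤ R ^ 2 →
      ∀ s ≥ s₀, ∀ σ γ, σ = s / (t * (T - t)) → 1 ≤ γ → γ ≤ Γ →
        W.fluxDeriv v σ (-(s * (T - 2 * t) / (t * (T - t)) ^ 2)) t
        - ν * ((T - 2 * t) * (1 + 2 * M * σ) * Real.exp (-(2 * M * σ)) * γ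
              * (∫ x in (0 : ℝ)..L, (L - x) ^ 3 * pdx (pdx v) t x ^ 2)
            + t * (T - t) * Real.exp (-(2 * M * σ)) * (γ * (2 * (L + 1) * (L + (1 + L) / L)
              * ∫ x in (0 : ℝ)..L, (ξ t x ^ 2 + pdx ξ t x ^ 2)))
              * (∫ x in (0 : ℝ)..L, (L - x) ^ 3 * pdx (pdx v) t x ^ 2)
            + t * (T - t) * Real.exp (-(2 * M * σ)) * γ
              * ∫ x in (0 : ℝ)..L, (L - x) ^ 3
                * (2 * pdx (pdx v) t x * pdt (pdx (pdx v)) t x))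
        + μ * (∫ x in (0 : ℝ)..L, ((m * σ) ^ 5 * v t x ^ 2 + (m * σ) ^ 3 * pdx v t x ^ 2
            + m * σ * pdx (pdx v) t x ^ 2) * Real.exp (-(2 * M * σ)))
        ≤ C * (((t * (T - t))⁻¹) ^ 31 * Real.exp (-((8 * m - 6 * M) * σ))
          * ∫ x in l1..l2, v t x ^ 2) := by
  have hL : 0 < L := by linarith
  have hM : 0 < M := hm.trans hmM
  obtain ⟨σ₀, κ, K, hσ₀, hκ, hK, carl⟩ := W.slice_estimate hL R
  obtain ⟨Ki, hKi, interp⟩ := exists_interpolation_const hl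
  obtain ⟨ν, C, hν, hC, comb⟩ := exists_combination_const (L := L) hT hL hm hmM hκ hK hΓ
    (Cp := 1 + ((l2 - l1) ^ 2) ^ 2 + ((l2 - l1) ^ 2) ^ 4)
    (by linarith [(by positivity : 0 ≤ ((l2 - l1) ^ 2) ^ 2 + ((l2 - l1) ^ 2) ^ 4)]) hKi
    (C3 := ((l2 - l1) ^ 2) ^ 6 / (L - l2) ^ 2) (by positivity)
  refine ⟨max 1 (max (σ₀ * T ^ 2) T), ν, κ / 2 / (m + m ^ 3 + m ^ 5), C * (T ^ 2) ^ 29,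
    le_max_left _ _, ?_, hν, by positivity, by positivity, ?_⟩
  · exact le_max_of_le_right (le_max_of_le_left (le_mul_of_one_le_left (sq_nonneg T) hσ₀))
  intro ξ v sol t ht hξ s hs σ γ hσ hγ1 hγ
  simp only [ge_iff_le, max_le_iff] at hs
  obtain ⟨hs1, hsσ, hsT⟩ := hs
  have ht' : 0 < T - t := by linarith [ht.2]
  have ht0 : 0 < t := ht.1
  obtain ⟨w, hw⟩ : ∃ w, w = t * (T - t) := ⟨_, rfl⟩
  rw [← hw] at hσ ⊢
  have hw0 : 0 < w := by rw [hw]; positivity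
  have hwT : w ≤ T ^ 2 := by
    rw [hw, sq]
    exact mul_le_mul ht.2.le (by linarith) ht'.le hT.le
  have hs0 : 0 < s := by linarith
  have hσσ₀ : σ₀ ≤ σ := by
    rw [hσ, le_div_iff₀ hw0]
    exact (mul_le_mul_of_nonneg_left hwT (by linarith)).trans hsσ
  have hσ1 : 1 ≤ σ := hσ₀.trans hσσ₀
  have hσ0 : 0 < σ := by linarith
  have hT2 : |T - 2 * t| ≤ T := abs_le.2 ⟨by linarith [ht.2], by linarith⟩
  have hσ₁ : |-(s * (T - 2 * t) / w ^ 2)| ≤ σ ^ 2 := by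
    rw [abs_neg, abs_div, abs_mul, abs_of_pos hs0, abs_of_pos (by positivity : 0 < w ^ 2), hσ,
      div_pow]
    gcongr
    rw [sq]
    gcongr
    exact hT2.trans hsT
  have cξ := continuous_slice sol.smooth_coeff t
  have c0 := continuous_slice sol.smooth t
  have c1 := continuous_slice sol.smooth_pdx t
  have c2 := continuous_slice sol.smooth_pdx2 t
  have c3 := continuous_slice sol.smooth_pdx3 t
  have cb := W.cont0
  have bc := sol.bc t (Ioo_subset_Icc_self ht)
  have e1 := carl σ hσσ₀ _ hσ₁ (ξ t) (v t) (pdx v t) (pdx (pdx v) t) (pdx (pdx (pdx v)) t)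
    (pdt v t) (pdx (pdt v) t) cξ hξ (hasDerivAt_pdx sol.smooth t) (hasDerivAt_pdx sol.smooth_pdx t)
    (hasDerivAt_pdx sol.smooth_pdx2 t) c3 (hasDerivAt_pdx sol.smooth_pdt t)
    (continuous_slice (contDiff_pdx sol.smooth_pdt) t) (sol.pdt_eq hL ht) bc.1 bc.2.2 bc.2.1
    (sol.pdt_right_eq_zero ht)
  have e2 := smoothing_slice_estimate hL (hasDerivAt_pdx sol.smooth_coeff t)
    (continuous_slice (contDiff_pdx sol.smooth_coeff) t) (hasDerivAt_pdx sol.smooth_pdx t)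
    (hasDerivAt_pdx sol.smooth_pdx2 t) (hasDerivAt_pdx sol.smooth_pdx3 t)
    (hasDerivAt_pdx sol.smooth_pdx4 t) (continuous_slice (contDiff_pdx sol.smooth_pdx4) t)
    (f1 := advectionDeriv ξ v t) (fun x => rfl) (hasDerivAt_pdx sol.smooth_advectionDeriv t)
    (continuous_slice (contDiff_pdx sol.smooth_advectionDeriv) t) (sol.pdt_pdx2_eq hL ht) bc.2.2
    (sol.pdx3_left_eq_zero hL ht) (sol.pdx4_left_add_eq_zero hL ht)
  have e3 := integral_bump_mul_le hl1.le hl.le hl2.le hσ1 cb (fun x hx => (hW x hx).1) c0 c1 c2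
  have e4 := integral_window_sq_le hl1.le hl.le hl2 c3
  have e5 := fun a ha ha1 => interp a ha ha1 (v t) _ _ _ (hasDerivAt_pdx sol.smooth t)
    (hasDerivAt_pdx sol.smooth_pdx t) (hasDerivAt_pdx sol.smooth_pdx2 t) c3
  have hexp : ∀ x ∈ Icc 0 L, Real.exp (-(2 * M * σ)) ≤ Real.exp (-(σ * W.b0 x)) ^ 2 := by
    intro x hx
    rw [← Real.exp_nat_mul, Real.exp_le_exp]
    have : σ * W.b0 x ≤ σ * M := by
      gcongr
      exact (hW x hx).2
    push_cast
    linarith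
  have e6 : Real.exp (-(2 * M * σ)) * (∫ x in (0 : ℝ)..L, pdx (pdx v) t x ^ 2)
      ≤ ∫ x in (0 : ℝ)..L, Real.exp (-(σ * W.b0 x)) ^ 2
        * (pdx (pdx v) t x ^ 2 + (σ * pdx v t x) ^ 2 + (σ ^ 2 * v t x) ^ 2) := by
    rw [← intervalIntegral.integral_const_mul]
    refine intervalIntegral.integral_mono_on hL.le (Continuous.intervalIntegrable (by fun_prop) _ _)
      (Continuous.intervalIntegrable (by fun_prop) _ _) fun x hx => ?_
    refine mul_le_mul (hexp x hx) ?_ (sq_nonneg _) (sq_nonneg _)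
    rw [add_assoc]
    exact le_add_of_nonneg_right (by positivity)
  have e7 : ∫ x in (0 : ℝ)..L, (L - x) ^ 3 * pdx (pdx v) t x ^ 2
      ≤ L ^ 3 * ∫ x in (0 : ℝ)..L, pdx (pdx v) t x ^ 2 := by
    rw [← intervalIntegral.integral_const_mul]
    refine intervalIntegral.integral_mono_on hL.le (Continuous.intervalIntegrable (by fun_prop) _ _)
      (Continuous.intervalIntegrable (by fun_prop) _ _) fun x hx => ?_
    have h1 := hx.1
    have h2 : 0 ≤ L - x := by linarith [hx.2]
    gcongr
    linarith
  have e8 : ∫ x in (0 : ℝ)..L, ((m * σ) ^ 5 * v t x ^ 2 + (m * σ) ^ 3 * pdx v t x ^ 2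
        + m * σ * pdx (pdx v) t x ^ 2) * Real.exp (-(2 * M * σ))
      ≤ (m + m ^ 3 + m ^ 5) * (σ * ∫ x in (0 : ℝ)..L, Real.exp (-(σ * W.b0 x)) ^ 2
        * (pdx (pdx v) t x ^ 2 + (σ * pdx v t x) ^ 2 + (σ ^ 2 * v t x) ^ 2)) := by
    rw [← intervalIntegral.integral_const_mul, ← intervalIntegral.integral_const_mul]
    refine intervalIntegral.integral_mono_on hL.le (Continuous.intervalIntegrable (by fun_prop) _ _)
      (Continuous.intervalIntegrable (by fun_prop) _ _) fun x hx => ?_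
    have h1 : (m * σ) ^ 5 * v t x ^ 2 + (m * σ) ^ 3 * pdx v t x ^ 2 + m * σ * pdx (pdx v) t x ^ 2
        ≤ (m + m ^ 3 + m ^ 5)
          * (σ * (pdx (pdx v) t x ^ 2 + (σ * pdx v t x) ^ 2 + (σ ^ 2 * v t x) ^ 2)) := by
      have p1 : 0 ≤ (m + m ^ 3) * σ * (σ ^ 2 * v t x) ^ 2 := by positivity
      have p2 : 0 ≤ (m + m ^ 5) * σ * (σ * pdx v t x) ^ 2 := by positivity
      have p3 : 0 ≤ (m ^ 3 + m ^ 5) * σ * pdx (pdx v) t x ^ 2 := by positivity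
      linarith
    have h2 := hexp x hx
    calc _ ≤ (m + m ^ 3 + m ^ 5)
          * (σ * (pdx (pdx v) t x ^ 2 + (σ * pdx v t x) ^ 2 + (σ ^ 2 * v t x) ^ 2))
          * Real.exp (-(σ * W.b0 x)) ^ 2 := by gcongr
      _ = _ := by ring
  have nn : ∀ f : ℝ → ℝ, (∀ x, 0 ≤ f x) → 0 ≤ ∫ x in (0 : ℝ)..L, f x := fun f hf =>
    intervalIntegral.integral_nonneg hL.le fun x _ => hf x
  have nn' : ∀ f : ℝ → ℝ, (∀ x, 0 ≤ f x) → 0 ≤ ∫ x in l1..l2, f x := fun f hf =>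
    intervalIntegral.integral_nonneg hl.le fun x _ => hf x
  have hI0 : 0 ≤ ∫ x in l1..l2, v t x ^ 2 := nn' _ fun x => sq_nonneg _
  rw [hWP] at e1
  have hθ : |(T - 2 * t) * (1 + 2 * M * σ) * Real.exp (-(2 * M * σ))|
      ≤ T * (1 + 2 * M * σ) * Real.exp (-(2 * M * σ)) := by
    rw [abs_mul, abs_mul, abs_of_pos (Real.exp_pos _),
      abs_of_pos (by positivity : 0 < 1 + 2 * M * σ)]
    gcongr
  have fin := comb σ w _ γ hσ1 hw0 hwT hθ hγ1 hγ _ _ _ _ _ _ _ _ _ _ _ _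
    (nn _ fun x => sq_nonneg (pdx (pdx v) t x)) (nn _ fun x => by positivity) hI0
    (add_nonneg (nn' _ fun x => by positivity) (nn' _ fun x => by positivity))
    (intervalIntegral.integral_nonneg hL.le fun x hx => by
      have : 0 ≤ L - x := by linarith [hx.2]
      positivity) e1 e2 e6 e7 e3 e5 e4
  have e9 := mul_le_mul_of_nonneg_left e8 (by positivity : 0 ≤ κ / 2 / (m + m ^ 3 + m ^ 5))
  rw [← mul_assoc, div_mul_cancel₀ _ (by positivity)] at e9
  have e10 : (w⁻¹) ^ 2 ≤ (T ^ 2) ^ 29 * (w⁻¹) ^ 31 := by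
    have h1 : 1 ≤ T ^ 2 * w⁻¹ := by
      rw [← div_eq_mul_inv]
      exact (one_le_div hw0).2 hwT
    calc (w⁻¹) ^ 2 ≤ (w⁻¹) ^ 2 * (T ^ 2 * w⁻¹) ^ 29 :=
          le_mul_of_one_le_right (by positivity) (one_le_pow₀ h1)
      _ = _ := by ring
  have e11 : C * (w⁻¹) ^ 2 * Real.exp ((6 * M - 8 * m) * σ) * (∫ x in l1..l2, v t x ^ 2)
      ≤ C * (T ^ 2) ^ 29 * ((w⁻¹) ^ 31 * Real.exp (-((8 * m - 6 * M) * σ))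
        * ∫ x in l1..l2, v t x ^ 2) := by
    have : -((8 * m - 6 * M) * σ) = (6 * M - 8 * m) * σ := by ring
    rw [this]
    calc _ ≤ C * ((T ^ 2) ^ 29 * (w⁻¹) ^ 31) * Real.exp ((6 * M - 8 * m) * σ)
          * (∫ x in l1..l2, v t x ^ 2) := by gcongr
      _ = _ := by ring
  rw [CarlemanWeight.fluxDeriv]
  linarith

theorem continuous_uncurry_sq {u : ℝ → ℝ → ℝ} (cu : Continuous (Function.uncurry u)) :
    Continuous (Function.uncurry fun t x => u t x ^ 2) := cu.pow 2

open Set MeasureTheory in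
/-- A differential inequality for a functional that vanishes linearly at both ends of the time
interval integrates to a sign condition. -/
theorem integral_nonneg_of_hasDerivAt_le {T K : ℝ} (hT : 0 < T) {Φ Φ' φ : ℝ → ℝ}
    (hderiv : ∀ t ∈ Ioo 0 T, HasDerivAt Φ (Φ' t) t)
    (hΦ : ∀ t ∈ Icc 0 T, |Φ t| ≤ K * (t * (T - t))) (hφ : IntegrableOn φ (Icc 0 T))
    (hle : ∀ t ∈ Ioo 0 T, Φ' t ≤ φ t) : 0 ≤ ∫ t in (0 : ℝ)..T, φ t := by
  have h0 : Φ 0 = 0 := abs_nonpos_iff.1 (by simpa using hΦ 0 (left_mem_Icc.2 hT.le))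
  have h1 : Φ T = 0 := abs_nonpos_iff.1 (by simpa using hΦ T (right_mem_Icc.2 hT.le))
  have hend : ∀ a, Φ a = 0 → a * (T - a) = 0 → ContinuousWithinAt Φ (Icc 0 T) a := by
    intro a ha haw
    have c : Continuous fun t => K * (t * (T - t)) := by fun_prop
    have h := c.tendsto a
    simp only [haw, mul_zero] at h
    rw [ContinuousWithinAt, ha]
    refine squeeze_zero_norm' ?_ (h.mono_left nhdsWithin_le_nhds)
    filter_upwards [self_mem_nhdsWithin] with t ht using hΦ t ht
  have hcont : ContinuousOn Φ (Icc 0 T) := by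
    intro t ht
    rcases eq_or_lt_of_le ht.1 with h | h
    · subst h
      exact hend _ h0 (by simp)
    rcases eq_or_lt_of_le ht.2 with h' | h'
    · subst h'
      exact hend _ h1 (by simp)
    · exact (hderiv t ⟨h, h'⟩).continuousAt.continuousWithinAt
  have := intervalIntegral.sub_le_integral_of_hasDeriv_right_of_le hT.le hcont
    (fun t ht => (hderiv t ht).hasDerivWithinAt) hφ hle
  rwa [h0, h1, sub_zero] at this

open Set in
theorem hasDerivAt_div_window {T s t : ℝ} (ht : t ∈ Ioo 0 T) :
    HasDerivAt (fun t => s / (t * (T - t))) (-(s * (T - 2 * t) / (t * (T - t)) ^ 2)) t := by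
  have hw : t * (T - t) ≠ 0 := (mul_pos ht.1 (sub_pos.2 ht.2)).ne'
  have h1 : HasDerivAt (fun t => t * (T - t)) (T - 2 * t) t := by
    refine ((hasDerivAt_id' t).fun_mul ((hasDerivAt_id' t).const_sub T)).congr_deriv ?_
    ring
  refine ((hasDerivAt_const t s).fun_div h1 hw).congr_deriv ?_
  ring

open Set in
theorem hasDerivAt_window_mul_exp {T s t : ℝ} (M : ℝ) (ht : t ∈ Ioo 0 T) :
    HasDerivAt (fun t => t * (T - t) * Real.exp (-(2 * M * (s / (t * (T - t))))))
      ((T - 2 * t) * (1 + 2 * M * (s / (t * (T - t))))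
        * Real.exp (-(2 * M * (s / (t * (T - t)))))) t := by
  have hw : t * (T - t) ≠ 0 := (mul_pos ht.1 (sub_pos.2 ht.2)).ne'
  have h1 : HasDerivAt (fun t => t * (T - t)) (T - 2 * t) t := by
    refine ((hasDerivAt_id' t).fun_mul ((hasDerivAt_id' t).const_sub T)).congr_deriv ?_
    ring
  refine (h1.fun_mul (((hasDerivAt_div_window (s := s) ht).const_mul (2 * M)).fun_neg.exp)
    ).congr_deriv ?_
  have h2 : t * (T - t) * (s * (T - 2 * t) / (t * (T - t)) ^ 2)
      = s / (t * (T - t)) * (T - 2 * t) := by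
    rw [pow_two]
    field_simp
  linear_combination 2 * M * Real.exp (-(2 * M * (s / (t * (T - t))))) * h2

/-- The exponential of the accumulated size of the coefficient is a bounded integrating factor. -/
theorem exists_integrating_factor {T B k : ℝ} (hk : 0 ≤ k) {g : ℝ → ℝ}
    (cg : Continuous g) (hg : ∀ t, 0 ≤ g t) (hB : (∫ t in (0 : ℝ)..T, g t) ≤ B) :
    ∃ γ : ℝ → ℝ, (∀ t, HasDerivAt γ (γ t * (k * g t)) t) ∧
      ∀ t ∈ Set.Icc 0 T, 1 ≤ γ t ∧ γ t ≤ Real.exp (k * B) := by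
  refine ⟨fun t => Real.exp (k * ∫ r in (0 : ℝ)..t, g r), fun t => ?_, fun t ht => ⟨?_, ?_⟩⟩
  · exact ((intervalIntegral.integral_hasDerivAt_right (cg.intervalIntegrable _ _)
      (cg.stronglyMeasurableAtFilter _ _) cg.continuousAt).const_mul k).exp
  · exact Real.one_le_exp (mul_nonneg hk
      (intervalIntegral.integral_nonneg ht.1 fun r _ => hg r))
  · refine Real.exp_le_exp.2 (mul_le_mul_of_nonneg_left (le_trans ?_ hB) hk)
    exact intervalIntegral.integral_mono_interval le_rfl ht.1 ht.2
      (Filter.Eventually.of_forall hg) (cg.intervalIntegrable _ _)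

open Set MeasureTheory in
theorem integrableOn_weighted_energy {T L m M s : ℝ} (hM : 0 < M) (hs : 0 ≤ s) {v : ℝ → ℝ → ℝ}
    (hv : ContDiff ℝ (⊤ : ℕ∞) (Function.uncurry v)) :
    IntegrableOn (fun t => ∫ x in (0 : ℝ)..L,
      ((m * (s / (t * (T - t)))) ^ 5 * v t x ^ 2 + (m * (s / (t * (T - t)))) ^ 3 * pdx v t x ^ 2
        + m * (s / (t * (T - t))) * pdx (pdx v) t x ^ 2)
        * Real.exp (-(2 * M * (s / (t * (T - t)))))) (Icc 0 T) := by
  have cv := hv.continuous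
  have cv1 := (contDiff_pdx hv).continuous
  have cv2 := (contDiff_pdx (contDiff_pdx hv)).continuous
  have mσ : Measurable fun t => s / (t * (T - t)) := by fun_prop
  have h0 : ∀ t ∈ Icc 0 T, 0 ≤ s / (t * (T - t)) := fun t ht =>
    div_nonneg hs (mul_nonneg ht.1 (sub_nonneg.2 ht.2))
  have hd : 0 < 2 * M := by positivity
  have I : ∀ (n : ℕ) {u : ℝ → ℝ → ℝ}, Continuous (Function.uncurry u) → IntegrableOn
      (fun t => (s / (t * (T - t))) ^ n * Real.exp (-(2 * M * (s / (t * (T - t)))))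
        * ∫ x in (0 : ℝ)..L, u t x ^ 2) (Icc 0 T) := fun n u cu =>
    integrableOn_pow_mul_exp_mul n hd mσ h0
      (continuous_integral_slice (F := fun t x => u t x ^ 2) (continuous_uncurry_sq cu))
  have slice : ∀ {u : ℝ → ℝ → ℝ} (_ : Continuous (Function.uncurry u)) (t k : ℝ),
      IntervalIntegrable (fun x => k * u t x ^ 2) volume 0 L := fun {u} cu t k =>
    Continuous.intervalIntegrable (by
      have : Continuous (u t) := cu.comp (by fun_prop : Continuous fun x => (t, x))
      fun_prop) _ _
  refine ((((I 5 cv).const_mul (m ^ 5)).add ((I 3 cv1).const_mul (m ^ 3))).add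
    ((I 1 cv2).const_mul m)).congr (Filter.Eventually.of_forall fun t => ?_)
  simp only [Pi.add_apply]
  rw [intervalIntegral.integral_mul_const, intervalIntegral.integral_add
    ((slice cv t _).add (slice cv1 t _)) (slice cv2 t _), intervalIntegral.integral_add
    (slice cv t _) (slice cv1 t _)]
  simp only [intervalIntegral.integral_const_mul]
  ring

open Set MeasureTheory in
theorem integrableOn_weighted_observation {T c d k s : ℝ} (hk : 0 < k) (hs : 0 < s)
    {v : ℝ → ℝ → ℝ} (cv : Continuous (Function.uncurry v)) :
    IntegrableOn (fun t => ((t * (T - t))⁻¹) ^ 31 * Real.exp (-(k * (s / (t * (T - t)))))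
      * ∫ x in c..d, v t x ^ 2) (Icc 0 T) := by
  have h := integrableOn_pow_mul_exp_mul (T := T) 31 hk
    (σ := fun t => s / (t * (T - t))) (by fun_prop)
    (fun t ht => div_nonneg hs.le (mul_nonneg ht.1 (sub_nonneg.2 ht.2)))
    (continuous_integral_slice (c := c) (d := d) (F := fun t x => v t x ^ 2)
      (continuous_uncurry_sq cv))
  refine (h.const_mul ((s⁻¹) ^ 31)).congr (Filter.Eventually.of_forall fun t => ?_)
  have : (s⁻¹) ^ 31 * (s / (t * (T - t))) ^ 31 = ((t * (T - t))⁻¹) ^ 31 := by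
    rw [← mul_pow]
    congr 1
    field_simp
  simp only [← this]
  ring

open Set in
/-- The time functional of the Carleman estimate vanishes linearly at the ends of the time
interval. -/
theorem CarlemanWeight.exists_abs_flux_le_window {T L m s : ℝ} (hT : 0 < T) (hL : 0 < L)
    (hm : 0 < m) (W : CarlemanWeight L) (hW : ∀ x ∈ Icc 0 L, m ≤ W.b0 x)
    {v : ℝ → ℝ → ℝ} (hv : ContDiff ℝ (⊤ : ℕ∞) (Function.uncurry v)) (hs : 0 < s)
    (hsT : T ^ 2 ≤ s) :
    ∃ K, ∀ t ∈ Icc 0 T, |W.flux v (s / (t * (T - t))) t| ≤ K * (t * (T - t)) := by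
  obtain ⟨K, hK, hflux⟩ := W.exists_abs_flux_le (T := T) hL hW hv
  obtain ⟨C, hC, hexp⟩ := exists_pow_mul_exp_neg_le 4 (by positivity : 0 < 2 * m)
  refine ⟨K * C / s, fun t ht => ?_⟩
  rcases eq_or_lt_of_le (mul_nonneg ht.1 (sub_nonneg.2 ht.2)) with hw | hw
  · simp [← hw, CarlemanWeight.flux]
  have hwT : t * (T - t) ≤ T ^ 2 := by
    rw [sq]
    exact mul_le_mul ht.2 (by linarith [ht.1]) (sub_nonneg.2 ht.2) hT.le
  set w := t * (T - t)
  have h1 : 1 ≤ s / w := (one_le_div hw).2 (hwT.trans hsT)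
  have h2 := hexp (s / w) (by linarith)
  calc |W.flux v (s / w) t| ≤ K * ((s / w) ^ 3 * Real.exp (-(2 * m * (s / w)))) := hflux t ht _ h1
    _ = K * ((s / w) ^ 4 * Real.exp (-(2 * m * (s / w)))) / s * w := by
        field_simp
    _ ≤ K * C / s * w := by gcongr

open Set in
theorem carleman_of_slice_inequality {T L l1 l2 m M s ν μ C k B Γ : ℝ} (hT : 0 < T) (hL : 0 < L)
    (hm : 0 < m) (hM : 0 < M) (hmM : 6 * M < 8 * m) (W : CarlemanWeight L)
    (hW : ∀ x ∈ Icc 0 L, m ≤ W.b0 x) (hs : 0 < s) (hsT : T ^ 2 ≤ s) (hν : 0 ≤ ν) (hk : 0 ≤ k)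
    {ξ v : ℝ → ℝ → ℝ} (sol : IsAdjointSolution T L ξ v)
    (hB : (∫ t in (0 : ℝ)..T, ∫ x in (0 : ℝ)..L, (ξ t x ^ 2 + pdx ξ t x ^ 2)) ≤ B)
    (hΓ : Γ = Real.exp (k * B))
    (hslice : ∀ t ∈ Ioo 0 T, ∀ σ γ, σ = s / (t * (T - t)) → 1 ≤ γ → γ ≤ Γ →
        W.fluxDeriv v σ (-(s * (T - 2 * t) / (t * (T - t)) ^ 2)) t
        - ν * ((T - 2 * t) * (1 + 2 * M * σ) * Real.exp (-(2 * M * σ)) * γ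
              * (∫ x in (0 : ℝ)..L, (L - x) ^ 3 * pdx (pdx v) t x ^ 2)
            + t * (T - t) * Real.exp (-(2 * M * σ)) * (γ * (k
              * ∫ x in (0 : ℝ)..L, (ξ t x ^ 2 + pdx ξ t x ^ 2)))
              * (∫ x in (0 : ℝ)..L, (L - x) ^ 3 * pdx (pdx v) t x ^ 2)
            + t * (T - t) * Real.exp (-(2 * M * σ)) * γ
              * ∫ x in (0 : ℝ)..L, (L - x) ^ 3
                * (2 * pdx (pdx v) t x * pdt (pdx (pdx v)) t x))
        + μ * (∫ x in (0 : ℝ)..L, ((m * σ) ^ 5 * v t x ^ 2 + (m * σ) ^ 3 * pdx v t x ^ 2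
            + m * σ * pdx (pdx v) t x ^ 2) * Real.exp (-(2 * M * σ)))
        ≤ C * (((t * (T - t))⁻¹) ^ 31 * Real.exp (-((8 * m - 6 * M) * σ))
          * ∫ x in l1..l2, v t x ^ 2)) :
    μ * (∫ t in (0 : ℝ)..T, ∫ x in (0 : ℝ)..L,
      ((m * (s / (t * (T - t)))) ^ 5 * v t x ^ 2 + (m * (s / (t * (T - t)))) ^ 3 * pdx v t x ^ 2
        + m * (s / (t * (T - t))) * pdx (pdx v) t x ^ 2)
        * Real.exp (-(2 * M * (s / (t * (T - t))))))
      ≤ C * ∫ t in (0 : ℝ)..T, ((t * (T - t))⁻¹) ^ 31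
        * Real.exp (-((8 * m - 6 * M) * (s / (t * (T - t))))) * ∫ x in l1..l2, v t x ^ 2 := by
  have cξ := sol.smooth_coeff.continuous
  have cξ1 := (contDiff_pdx sol.smooth_coeff).continuous
  obtain ⟨γ, hγ', hγ⟩ := exists_integrating_factor (T := T) hk
    (continuous_integral_slice (c := 0) (d := L) (F := fun t x => ξ t x ^ 2 + pdx ξ t x ^ 2)
      (show Continuous fun p : ℝ × ℝ => Function.uncurry ξ p ^ 2 + Function.uncurry (pdx ξ) p ^ 2 by
        fun_prop))
    (fun t => intervalIntegral.integral_nonneg hL.le fun x _ => by positivity) hB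
  rw [← hΓ] at hγ
  have hY' : ∀ t, HasDerivAt (fun t => ∫ x in (0 : ℝ)..L, (L - x) ^ 3 * pdx (pdx v) t x ^ 2) _ t :=
    hasDerivAt_integral_cube_mul_sq hL sol.smooth_pdx2
  obtain ⟨N, hN⟩ := (isCompact_Icc (a := (0 : ℝ)) (b := T)).exists_bound_of_continuousOn
    (f := fun t => ∫ x in (0 : ℝ)..L, (L - x) ^ 3 * pdx (pdx v) t x ^ 2)
    fun t _ => (hY' t).continuousAt.continuousWithinAt
  obtain ⟨K, hK⟩ := W.exists_abs_flux_le_window (T := T) hT hL hm hW sol.smooth hs hsT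
  have i1 := integrableOn_weighted_energy (T := T) (L := L) (m := m) hM hs.le sol.smooth
  have i2 := integrableOn_weighted_observation (T := T) (c := l1) (d := l2)
    (by linarith : 0 < 8 * m - 6 * M) hs sol.smooth.continuous
  have key := integral_nonneg_of_hasDerivAt_le (K := K + ν * (Γ * N)) hT
    (Φ := fun t => W.flux v (s / (t * (T - t))) t
      - ν * (t * (T - t) * Real.exp (-(2 * M * (s / (t * (T - t))))) * γ t
        * ∫ x in (0 : ℝ)..L, (L - x) ^ 3 * pdx (pdx v) t x ^ 2))
    (fun t ht => (W.hasDerivAt_flux hL sol.smooth (fun t ht => hasDerivAt_div_window ht)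
        (ContinuousOn.neg (ContinuousOn.div (by fun_prop) (by fun_prop)
          fun t ht => (pow_pos (mul_pos ht.1 (sub_pos.2 ht.2)) 2).ne')) ht).sub
      ((((hasDerivAt_window_mul_exp M ht).fun_mul (hγ' t)).fun_mul (hY' t)).const_mul ν))
    ?_ ((i2.const_mul C).sub (i1.const_mul μ)) ?_
  · simp only [Pi.sub_apply] at key
    rw [intervalIntegral.integral_sub, intervalIntegral.integral_const_mul,
      intervalIntegral.integral_const_mul] at key
    · linarith
    · exact ((intervalIntegrable_iff_integrableOn_Icc_of_le hT.le).2 i2).const_mul C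
    · exact ((intervalIntegrable_iff_integrableOn_Icc_of_le hT.le).2 i1).const_mul μ
  · intro t ht
    have hw : 0 ≤ t * (T - t) := mul_nonneg ht.1 (sub_nonneg.2 ht.2)
    have hγt := hγ t ht
    have hexp : Real.exp (-(2 * M * (s / (t * (T - t))))) ≤ 1 :=
      Real.exp_le_one_iff.2 (neg_nonpos.2 (by positivity))
    refine (abs_sub _ _).trans ?_
    rw [add_mul]
    refine add_le_add (hK t ht) ?_
    have hγ0 : 0 ≤ γ t := by linarith
    rw [abs_mul, abs_of_nonneg hν, abs_mul, abs_mul, abs_mul, abs_of_nonneg hw,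
      abs_of_nonneg hγ0, abs_of_pos (Real.exp_pos _)]
    have hNt := hN t ht
    rw [Real.norm_eq_abs] at hNt
    calc _ ≤ ν * (t * (T - t) * 1 * Γ * N) := by
          have := hγt.2
          gcongr
          exact mul_nonneg (by linarith) (hγ0.trans this)
      _ = _ := by ring
  · intro t ht
    have hγt := hγ t (Ioo_subset_Icc_self ht)
    have h := hslice t ht _ (γ t) rfl hγt.1 hγt.2
    simp only [Pi.sub_apply]
    convert (le_sub_iff_add_le.2 h) using 1
    ring

open Set in
/-- The Carleman estimate for a weight with values between `m` and `M`. -/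
theorem exists_carleman_const {T L l1 l2 m M : ℝ} (hT : 0 < T) (hl1 : 0 < l1) (hl : l1 < l2)
    (hl2 : l2 < L) (hm : 0 < m) (hmM : m < M) (hMm : 6 * M < 8 * m) (W : CarlemanWeight L)
    (hWP : W.P = fun x => max 0 ((x - l1) * (l2 - x)) ^ 4)
    (hW : ∀ x ∈ Icc 0 L, m ≤ W.b0 x ∧ W.b0 x ≤ M) (R : ℝ) :
    ∃ s₀ C, 1 ≤ s₀ ∧ 0 < C ∧ ∀ ξ v : ℝ → ℝ → ℝ, IsAdjointSolution T L ξ v →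
      (∀ t ∈ Ioo 0 T, (∫ x in (0 : ℝ)..L, ξ t x ^ 2) ≤ R ^ 2) →
      (∫ t in (0 : ℝ)..T, ∫ x in (0 : ℝ)..L, (ξ t x ^ 2 + pdx ξ t x ^ 2)) ≤ R ^ 2 →
      ∀ s ≥ s₀, (∫ t in (0 : ℝ)..T, ∫ x in (0 : ℝ)..L,
        ((m * (s / (t * (T - t)))) ^ 5 * v t x ^ 2 + (m * (s / (t * (T - t)))) ^ 3 * pdx v t x ^ 2
          + m * (s / (t * (T - t))) * pdx (pdx v) t x ^ 2)
          * Real.exp (-(2 * M * (s / (t * (T - t))))))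
        ≤ C * ∫ t in (0 : ℝ)..T, ((t * (T - t))⁻¹) ^ 31
          * Real.exp (-((8 * m - 6 * M) * (s / (t * (T - t))))) * ∫ x in l1..l2, v t x ^ 2 := by
  have hL : 0 < L := by linarith
  have hk : 0 ≤ 2 * (L + 1) * (L + (1 + L) / L) := by positivity
  obtain ⟨s₀, ν, μ, C, hs₀, hs₀T, hν, hμ, hC, hslice⟩ := exists_slice_inequality hT hl1 hl hl2 hm
    hmM W hWP hW R (Γ := Real.exp (2 * (L + 1) * (L + (1 + L) / L) * R ^ 2))
    (Real.one_le_exp (by positivity))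
  refine ⟨s₀, C / μ, hs₀, by positivity, fun ξ v sol hξ hB s hs => ?_⟩
  rw [div_mul_eq_mul_div, le_div_iff₀' hμ]
  exact carleman_of_slice_inequality hT hL hm (hm.trans hmM) hMm W (fun x hx => (hW x hx).1)
    (by linarith) (hs₀T.trans hs) hν.le hk sol hB rfl
    fun t ht σ γ hσ => hslice ξ v sol t ht (hξ t ht) s hs σ γ hσ

/-- Carleman estimate with time-only weights
`φ̌(t) = ψ(l3)/(t(T−t))`, `φ̂(t) = ψ(0)/(t(T−t))` and `L²` internal observation
on `ω = (l1,l2)`, for solutions of the adjoint linearized KdV equation with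
potential `ξ` of norm `‖ξ‖_{C⁰([0,T];L²)} + ‖ξ‖_{L²(0,T;H¹)} ≤ R`
(expressed pointwise in `t`, which is equivalent). -/
theorem stmt_5 (T L l1 l2 : ℝ) (hT : 0 < T) (hl1 : 0 < l1) (hl12 : l1 < l2) (hl2 : l2 < L)
    (ψ : ℝ → ℝ) (l3 : ℝ) (hψ : ContDiff ℝ 3 ψ) (hl3 : l3 ∈ Set.Ioo l1 l2)
    (hC1 : ∀ x ∈ Set.Icc (0:ℝ) L, 0 < ψ x)
    (hC2 : ∀ x ∈ Set.Icc (0:ℝ) L, x ∉ Set.Ioo l1 l2 →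
      deriv ψ x ≠ 0 ∧ deriv (deriv ψ) x < 0 ∧
        deriv ψ x * deriv (deriv (deriv ψ)) x < 0)
    (hC3a : deriv ψ 0 < 0) (hC3b : 0 < deriv ψ L)
    (hC4min : ∀ x ∈ Set.Icc l1 l2, ψ l3 ≤ ψ x)
    (hC4max : ∀ x ∈ Set.Icc l1 l2, ψ x ≤ ψ l1)
    (hC4lt : ψ l3 < ψ l1) (hC4eq : ψ l1 = ψ l2)
    (hC4glob : ∀ x ∈ Set.Icc (0:ℝ) L, ψ x ≤ ψ 0) (hC4eq' : ψ 0 = ψ L)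
    (hC5 : ψ 0 < (4 / 3) * ψ l3)
    (φc φh : ℝ → ℝ)
    (hφc : φc = fun t => ψ l3 / (t * (T - t)))
    (hφh : φh = fun t => ψ 0 / (t * (T - t)))
    (R : ℝ) (hR : 0 < R) :
    ∃ s0 C : ℝ, 0 < s0 ∧ 0 < C ∧
      ∀ ξ : ℝ → ℝ → ℝ, ContDiff ℝ (⊤ : ℕ∞) (Function.uncurry ξ) →
        (∀ t ∈ Set.Icc (0:ℝ) T,
          Real.sqrt (∫ x in (0:ℝ)..L, (ξ t x) ^ 2)
            + Real.sqrt (∫ τ in (0:ℝ)..T, ∫ x in (0:ℝ)..L,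
                ((ξ τ x) ^ 2 + (pdx ξ τ x) ^ 2)) ≤ R) →
        ∀ s ≥ s0, ∀ v : ℝ → ℝ → ℝ, ContDiff ℝ (⊤ : ℕ∞) (Function.uncurry v) →
          (∀ t ∈ Set.Ioo (0:ℝ) T, ∀ x ∈ Set.Ioo (0:ℝ) L,
            -pdt v t x - ξ t x * pdx v t x - pdx (pdx (pdx v)) t x = 0) →
          (∀ t ∈ Set.Icc (0:ℝ) T, v t 0 = 0 ∧ v t L = 0 ∧ pdx v t 0 = 0) →
          (∫ t in (0:ℝ)..T, ∫ x in (0:ℝ)..L,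
              ((s * φc t) ^ 5 * (v t x) ^ 2 + (s * φc t) ^ 3 * (pdx v t x) ^ 2
                + s * φc t * (pdx (pdx v) t x) ^ 2) * Real.exp (-2 * s * φh t)) ≤
            C * s ^ 10 * ∫ t in (0:ℝ)..T,
                Real.exp (s * (6 * φh t - 8 * φc t)) * (φc t) ^ 31
                  * ∫ x in l1..l2, (v t x) ^ 2 := by
  have hl1L : l1 ∈ Set.Icc (0 : ℝ) L := ⟨hl1.le, (hl12.trans hl2).le⟩
  have hm : 0 < ψ l3 := hC1 l3 ⟨(hl1.trans hl3.1).le, (hl3.2.trans hl2).le⟩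
  have hmM : ψ l3 < ψ 0 := hC4lt.trans_le (hC4glob l1 hl1L)
  have hM : 0 < ψ 0 := hm.trans hmM
  obtain ⟨W, hb0, hP⟩ := exists_carlemanWeight (m := ψ l3) (δ := (ψ 0 - ψ l3) / ψ 0) hψ
    (fun x hx hx' => ⟨(hC2 x hx hx').1, (hC2 x hx hx').2.1⟩) hC3a hC3b
    (div_pos (sub_pos.2 hmM) hM)
  have hW : ∀ x ∈ Set.Icc 0 L, ψ l3 ≤ W.b0 x ∧ W.b0 x ≤ ψ 0 := by
    intro x hx
    have h1 := hC1 x hx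
    have h2 := hC4glob x hx
    have hd : 0 < (ψ 0 - ψ l3) / ψ 0 := div_pos (sub_pos.2 hmM) hM
    rw [hb0]
    refine ⟨by linarith [mul_pos hd h1], ?_⟩
    have h3 := mul_le_mul_of_nonneg_left h2 hd.le
    rw [div_mul_cancel₀ _ hM.ne'] at h3
    linarith
  obtain ⟨s₀, C, hs₀, hC, carl⟩ := exists_carleman_const hT hl1 hl12 hl2 hm hmM (by linarith) W hP
    hW R
  refine ⟨s₀, C / ψ l3 ^ 31, by linarith, by positivity, fun ξ hξ hnorm s hs v hv hpde hbc => ?_⟩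
  have hB1 : ∀ t ∈ Set.Icc 0 T, (∫ x in (0 : ℝ)..L, ξ t x ^ 2) ≤ R ^ 2 := fun t ht =>
    (Real.sqrt_le_left hR.le).1 ((le_add_of_nonneg_right (Real.sqrt_nonneg _)).trans (hnorm t ht))
  have hB2 : (∫ t in (0 : ℝ)..T, ∫ x in (0 : ℝ)..L, (ξ t x ^ 2 + pdx ξ t x ^ 2)) ≤ R ^ 2 :=
    (Real.sqrt_le_left hR.le).1 ((le_add_of_nonneg_left (Real.sqrt_nonneg _)).trans
      (hnorm 0 (Set.left_mem_Icc.2 hT.le)))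
  have h := carl ξ v ⟨hξ, hv, hpde, hbc⟩ (fun t ht => hB1 t (Set.Ioo_subset_Icc_self ht)) hB2 s hs
  have hobs : ∀ t, Real.exp (s * (6 * φh t - 8 * φc t)) * φc t ^ 31 * (∫ x in l1..l2, v t x ^ 2)
      = ψ l3 ^ 31 * (((t * (T - t))⁻¹) ^ 31
        * Real.exp (-((8 * ψ l3 - 6 * ψ 0) * (s / (t * (T - t))))) * ∫ x in l1..l2, v t x ^ 2) := by
    intro t
    rw [show s * (6 * φh t - 8 * φc t) = -((8 * ψ l3 - 6 * ψ 0) * (s / (t * (T - t)))) by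
      simp only [hφc, hφh]; ring, show φc t = ψ l3 * (t * (T - t))⁻¹ by simp only [hφc]; ring,
      mul_pow]
    ring
  have hnonneg : 0 ≤ ∫ t in (0 : ℝ)..T, ((t * (T - t))⁻¹) ^ 31
      * Real.exp (-((8 * ψ l3 - 6 * ψ 0) * (s / (t * (T - t))))) * ∫ x in l1..l2, v t x ^ 2 := by
    refine intervalIntegral.integral_nonneg hT.le fun t ht => ?_
    have h1 : 0 ≤ (t * (T - t))⁻¹ := inv_nonneg.2 (mul_nonneg ht.1 (sub_nonneg.2 ht.2))
    have h2 : 0 ≤ ∫ x in l1..l2, v t x ^ 2 :=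
      intervalIntegral.integral_nonneg hl12.le fun x _ => sq_nonneg _
    positivity
  have hlhs : ∀ t x, ((s * φc t) ^ 5 * v t x ^ 2 + (s * φc t) ^ 3 * pdx v t x ^ 2
        + s * φc t * pdx (pdx v) t x ^ 2) * Real.exp (-2 * s * φh t)
      = ((ψ l3 * (s / (t * (T - t)))) ^ 5 * v t x ^ 2
        + (ψ l3 * (s / (t * (T - t)))) ^ 3 * pdx v t x ^ 2
        + ψ l3 * (s / (t * (T - t))) * pdx (pdx v) t x ^ 2)
        * Real.exp (-(2 * ψ 0 * (s / (t * (T - t))))) := by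
    intro t x
    rw [show s * φc t = ψ l3 * (s / (t * (T - t))) by rw [hφc]; ring,
      show -2 * s * φh t = -(2 * ψ 0 * (s / (t * (T - t)))) by rw [hφh]; ring]
  simp only [hlhs, hobs, intervalIntegral.integral_const_mul]
  refine h.trans ?_
  rw [← mul_assoc, mul_right_comm (C / _), div_mul_cancel₀ _ (by positivity), mul_assoc]
  exact mul_le_mul_of_nonneg_left
    (le_mul_of_one_le_left hnonneg (one_le_pow₀ (hs₀.trans hs))) hC.le
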